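/- (Almost periodic cohomology) Let Γ be a cocompact Fuchsian group. Then for every integer m > 2, the group cohomology of Γ with trivial integer coefficients satisfies H^m(Γ; ℤ) ≅ H^{m+2}(Γ; ℤ). -/

import Mathlib

open UpperHalfPlane Matrix

/-- `SL(2,ℝ)`: 2×2 real matrices of determinant 1. -/
abbrev SL2R := Matrix.SpecialLinearGroup (Fin 2) ℝ

/-- The subspace topology on `SL(2,ℝ)` inherited from 2×2 real matrices. -/
instance : TopologicalSpace SL2R :=
  TopologicalSpace.induced (fun g => (g : Matrix (Fin 2) (Fin 2) ℝ)) inferInstance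

/-- `PSL(2,ℝ)`: the quotient of `SL(2,ℝ)` by its center `{±I}`,
with the quotient topology. -/
abbrev PSL2R := SL2R ⧸ Subgroup.center SL2R

namespace FuchsCoh

open CategoryTheory CategoryTheory.Limits



lemma acyclic_of_bij {G : Type} [Group G] {A B : Type} [AddCommGroup A] [AddCommGroup B]
    (ρ : Representation ℤ G A) (e : A →ₗ[ℤ] B)
    (h : Function.Bijective (fun (a : A) (g : G) => e (ρ g a))) (n : ℕ) :
    IsZero (groupCohomology (Rep.of ρ) (n + 1)) := by
  let T : Rep ℤ (⊥ : Subgroup G) := Rep.of (1 : Representation ℤ (⊥ : Subgroup G) B)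
  let F : A →ₗ[ℤ] Representation.coindV (⊥ : Subgroup G).subtype
      (1 : Representation ℤ (⊥ : Subgroup G) B) :=
    { toFun := fun a => ⟨fun g => e (ρ g a), by
        intro g h
        have : g = 1 := Subsingleton.elim _ _
        subst this
        simp⟩
      map_add' := by intro a b; ext g; simp
      map_smul' := by intro a b; ext g; simp }
  have hF : Function.Bijective F := by
    constructor
    · intro a b hab
      apply h.1
      exact congrArg Subtype.val hab
    · intro y
      obtain ⟨a, ha⟩ := h.2 y.1
      exact ⟨a, Subtype.ext ha⟩
  let E : ρ.Equiv (Representation.coind (⊥ : Subgroup G).subtype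
      (1 : Representation ℤ (⊥ : Subgroup G) B)) :=
    { LinearEquiv.ofBijective F hF with
      isIntertwining' := by
        intro g
        ext a x
        change e (ρ x (ρ g a)) = e (ρ (x * g) a)
        simp }
  have iso : groupCohomology (Rep.of ρ) (n + 1) ≅ groupCohomology (Rep.coind (⊥ : Subgroup G).subtype T) (n + 1) :=
    (groupCohomology.functor ℤ G (n + 1)).mapIso (Rep.mkIso E)
  exact ((isZero_groupCohomology_succ_of_subsingleton T n).of_iso
    (groupCohomology.coindIso T (n + 1))).of_iso iso

variable {G : Type} [Group G]

lemma exact_of' {k : Type} [CommRing k] {S : ShortComplex (Rep.{0} k G)}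
    (h : ∀ y, S.g.hom y = 0 → ∃ x, S.f.hom x = y) : S.Exact := by
  rw [← ShortComplex.exact_map_iff_of_faithful S (forget₂ (Rep.{0} k G) (ModuleCat.{0} k))]
  rw [ShortComplex.moduleCat_exact_iff]
  intro y hy
  exact h y hy

lemma exact_of {S : ShortComplex (Rep.{0} ℤ G)}
    (h : ∀ y, S.g.hom y = 0 → ∃ x, S.f.hom x = y) : S.Exact := exact_of' h

lemma resolution_shift {Z A0 A1 A2 : Rep.{0} ℤ G} (f0 : Z ⟶ A0) (f1 : A0 ⟶ A1) (f2 : A1 ⟶ A2)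
    (i0 : Function.Injective f0.hom) (w0 : f0 ≫ f1 = 0) (w1 : f1 ≫ f2 = 0)
    (e0 : ∀ y, f1.hom y = 0 → ∃ x, f0.hom x = y)
    (e1 : ∀ y, f2.hom y = 0 → ∃ x, f1.hom x = y)
    (s2 : Function.Surjective f2.hom)
    (h1 : ∀ n, IsZero (groupCohomology A1 (n + 1)))
    (h2 : ∀ n, IsZero (groupCohomology A2 (n + 1))) (m : ℕ) :
    Nonempty (groupCohomology Z (m + 3) ≅ groupCohomology A0 (m + 3)) := by
  have hex1 : (ShortComplex.mk f1 f2 w1).Exact := exact_of e1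
  have hex0 : (ShortComplex.mk f0 f1 w0).Exact := exact_of e0
  have : Mono f0 := (Rep.mono_iff_injective _).2 i0
  have : Epi f2 := (Rep.epi_iff_surjective _).2 s2
  let S1 : ShortComplex (Rep.{0} ℤ G) := ShortComplex.mk (kernel.ι f2) f2 (by simp)
  have hS1 : S1.ShortExact := 
    { exact := ShortComplex.exact_kernel _ }
  have : Epi (kernel.lift f2 f1 w1) := hex1.epi_kernelLift
  let S0 : ShortComplex (Rep.{0} ℤ G) := ShortComplex.mk f0 (kernel.lift f2 f1 w1)
    (by rw [← cancel_mono (kernel.ι f2)]; simp [w0])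
  have hS0 : S0.ShortExact := 
    { exact := by
        refine exact_of fun y hy => e0 y ?_
        have : f1 = kernel.lift f2 f1 w1 ≫ kernel.ι f2 := by simp
        rw [this]
        change (kernel.ι f2).hom ((kernel.lift f2 f1 w1).hom y) = 0
        change (kernel.lift f2 f1 w1).hom y = 0 at hy
        rw [hy, map_zero]}
  have hQ : ∀ n, IsZero (groupCohomology (kernel f2) (n + 2)) := fun n =>
    (ShortComplex.Exact.isZero_of_both_zeros (groupCohomology.mapShortComplex₁_exact hS1 (i := n + 1) (j := n + 2) rfl)
      ((h2 n).eq_of_src _ _) ((h1 (n+1)).eq_of_tgt _ _))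
  have ha : Mono ((groupCohomology.functor ℤ G (m+3)).map f0) :=
    (ShortComplex.exact_iff_mono _ ((hQ m).eq_of_src _ _)).1
      (groupCohomology.mapShortComplex₁_exact hS0 (i := m + 2) (j := m + 3) rfl)
  have hb : Epi ((groupCohomology.functor ℤ G (m+3)).map f0) :=
    (ShortComplex.exact_iff_epi _ ((hQ (m+1)).eq_of_tgt _ _)).1
      (groupCohomology.mapShortComplex₂_exact hS0 (m + 3))
  have hc : IsIso ((groupCohomology.functor ℤ G (m+3)).map f0) := isIso_of_mono_of_epi _
  exact ⟨@asIso _ _ _ _ ((groupCohomology.functor ℤ G (m+3)).map f0) hc⟩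

lemma periodic_shift {A B : Rep.{0} ℤ G} (f0 : A ⟶ B) (f1 : B ⟶ B) (f2 : B ⟶ A)
    (i0 : Function.Injective f0.hom) (w0 : f0 ≫ f1 = 0) (w1 : f1 ≫ f2 = 0)
    (e0 : ∀ y, f1.hom y = 0 → ∃ x, f0.hom x = y)
    (e1 : ∀ y, f2.hom y = 0 → ∃ x, f1.hom x = y)
    (s2 : Function.Surjective f2.hom)
    (h1 : ∀ n, IsZero (groupCohomology B (n + 1))) (m : ℕ) :
    Nonempty (groupCohomology A (m + 1) ≅ groupCohomology A (m + 3)) := by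
  have hex1 : (ShortComplex.mk f1 f2 w1).Exact := exact_of e1
  have hex0 : (ShortComplex.mk f0 f1 w0).Exact := exact_of e0
  have : Mono f0 := (Rep.mono_iff_injective _).2 i0
  have : Epi f2 := (Rep.epi_iff_surjective _).2 s2
  let S1 : ShortComplex (Rep.{0} ℤ G) := ShortComplex.mk (kernel.ι f2) f2 (by simp)
  have hS1 : S1.ShortExact := 
    { exact := ShortComplex.exact_kernel _ }
  have : Epi (kernel.lift f2 f1 w1) := hex1.epi_kernelLift
  let S0 : ShortComplex (Rep.{0} ℤ G) := ShortComplex.mk f0 (kernel.lift f2 f1 w1)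
    (by rw [← cancel_mono (kernel.ι f2)]; simp [w0])
  have hS0 : S0.ShortExact := 
    { exact := by
        refine exact_of fun y hy => e0 y ?_
        have : f1 = kernel.lift f2 f1 w1 ≫ kernel.ι f2 := by simp
        rw [this]
        change (kernel.ι f2).hom ((kernel.lift f2 f1 w1).hom y) = 0
        change (kernel.lift f2 f1 w1).hom y = 0 at hy
        rw [hy, map_zero]}
  have := groupCohomology.isIso_δ_of_isZero hS1 (m + 1) (h1 m) (h1 (m + 1))
  have := groupCohomology.isIso_δ_of_isZero hS0 (m + 2) (h1 (m+1)) (h1 (m + 2))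
  exact ⟨asIso (groupCohomology.δ hS1 (m+1) (m+2) rfl) ≪≫
    asIso (groupCohomology.δ hS0 (m+2) (m+3) rfl)⟩



/-! ### Functions on `G`-sets -/

/-- The permutation representation on integer valued functions. -/
def funRep {G Y : Type} [Group G] (act : G →* Equiv.Perm Y) : Representation ℤ G (Y → ℤ) where
  toFun g := LinearMap.funLeft ℤ ℤ (act g⁻¹)
  map_one' := by ext; simp [LinearMap.funLeft]
  map_mul' a b := by
    apply LinearMap.ext; intro f; funext y
    simp [LinearMap.funLeft]

lemma funRep_apply {G Y : Type} [Group G] (act : G →* Equiv.Perm Y) (g : G) (f : Y → ℤ) (y : Y) :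
    funRep act g f y = f (act g⁻¹ y) := rfl

lemma cyclic_solve {C : Type} [Group C] [Fintype C] (σ : C) (hσ : ∀ x, x ∈ Subgroup.zpowers σ)
    (f : C → ℤ) (hf : ∑ u, f u = 0) : ∃ g : C → ℤ, ∀ u, g (u * σ) - g u = f u := by
  classical
  have hpos : 0 < orderOf σ := orderOf_pos σ
  have hk : ∀ u : C, ∃ k, k < orderOf σ ∧ σ ^ k = u := by
    intro u
    have := (mem_zpowers_iff_mem_range_orderOf (x := σ) (y := u)).1 (hσ u)
    simpa using this
  choose k hk1 hk2 using hk
  have huniq : ∀ i < orderOf σ, k (σ ^ i) = i := fun i hi =>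
    pow_injOn_Iio_orderOf (hk1 _) hi (hk2 _)
  have htot : ∑ i ∈ Finset.range (orderOf σ), f (σ ^ i) = 0 := by
    rw [← hf]
    refine Finset.sum_bij (fun i _ => σ ^ i) (by simp) ?_ ?_ (by simp)
    · intro i hi j hj hij
      exact pow_injOn_Iio_orderOf (by simpa using hi) (by simpa using hj) hij
    · intro u _
      exact ⟨k u, by simpa using hk1 u, hk2 u⟩
  refine ⟨fun u => ∑ i ∈ Finset.range (k u), f (σ ^ i), fun u => ?_⟩
  have hu : u * σ = σ ^ (k u + 1) := by rw [pow_succ, hk2]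
  rcases Nat.lt_or_ge (k u + 1) (orderOf σ) with h | h
  · simp only
    rw [hu, huniq _ h, Finset.sum_range_succ, hk2]
    ring
  · have he : k u + 1 = orderOf σ := le_antisymm (hk1 u) h
    have h1 : k (u * σ) = 0 := by
      rw [hu, he, pow_orderOf_eq_one]
      simpa using huniq 0 hpos
    rw [← he, Finset.sum_range_succ, hk2] at htot
    simp only [h1]
    simp
    linarith

lemma funRep_periodic {X : Type} [MulAction G X]
    (hfin : ∀ x : X, Finite (MulAction.stabilizer G x))
    (hcyc : ∀ x : X, IsCyclic (MulAction.stabilizer G x)) (m : ℕ) :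
    Nonempty (groupCohomology (Rep.of (funRep (MulAction.toPermHom G X))) (m + 1) ≅
      groupCohomology (Rep.of (funRep (MulAction.toPermHom G X))) (m + 3)) := by
  classical
  let Ω := MulAction.orbitRel.Quotient G X
  let q : X → Ω := fun x => Quotient.mk _ x
  let r : Ω → X := fun ω => Quotient.out ω
  have hqr : ∀ ω, q (r ω) = ω := fun ω => Quotient.out_eq ω
  have hq : ∀ (g : G) x, q (g • x) = q x := fun g x =>
    Quotient.sound (MulAction.orbitRel_apply.2 (MulAction.mem_orbit _ _))
  have hqh : ∀ (h : G) ω, q (h • r ω) = ω := fun h ω => by rw [hq, hqr]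
  have hτ : ∀ x, ∃ g : G, g • r (q x) = x := by
    intro x
    have : MulAction.orbitRel G X (r (q x)) x := Quotient.exact (hqr (q x))
    obtain ⟨g, hg⟩ := MulAction.orbitRel_apply.1 ((MulAction.orbitRel G X).symm this)
    exact ⟨g, hg⟩
  choose τ hτ using hτ
  let S : Ω → Subgroup G := fun ω => MulAction.stabilizer G (r ω)
  have : ∀ ω, Fintype (S ω) := fun ω => @Fintype.ofFinite _ (hfin _)
  have hσ : ∀ ω, ∃ σ : S ω, ∀ u, u ∈ Subgroup.zpowers σ := fun ω => (hcyc (r ω)).1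
  choose σ hσ using hσ
  let Y := Ω × G
  let act : G →* Equiv.Perm Y :=
    { toFun := fun g => Equiv.prodCongr (Equiv.refl Ω) (Equiv.mulLeft g)
      map_one' := by ext y <;> simp
      map_mul' := by intro a b; ext y <;> simp [mul_assoc] }
  have act_apply : ∀ g (y : Y), act g y = (y.1, g * y.2) := fun g y => rfl
  let ρX := funRep (MulAction.toPermHom G X)
  let ρY := funRep act
  have ρX_apply : ∀ g f x, ρX g f x = f (g⁻¹ • x) := fun g f x => rfl
  have ρY_apply : ∀ g f y, ρY g f y = f (y.1, g⁻¹ * y.2) := fun g f x => rfl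
  -- independence of the fibre sum
  have hsum : ∀ (F : Y → ℤ) (ω : Ω) (h h' : G), h • r ω = h' • r ω →
      ∑ u : S ω, F (ω, h * u) = ∑ u : S ω, F (ω, h' * u) := by
    intro F ω h h' hh
    have hv : h'⁻¹ * h ∈ S ω := by
      change (h'⁻¹ * h) • r ω = r ω
      rw [mul_smul, hh, inv_smul_smul]
    refine Fintype.sum_equiv (Equiv.mulLeft (⟨_, hv⟩ : S ω)) _ _ ?_
    intro u
    simp [mul_assoc]
  let f0 : ρX.IntertwiningMap ρY :=
    { toFun := fun f y => f (y.2 • r y.1)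
      map_add' := by intros; rfl
      map_smul' := by intros; rfl
      isIntertwining' := by
        intro g; ext f y
        change f (g⁻¹ • y.2 • r y.1) = f ((g⁻¹ * y.2) • r y.1)
        rw [mul_smul] }
  let f1 : ρY.IntertwiningMap ρY :=
    { toFun := fun F y => F (y.1, y.2 * σ y.1) - F y
      map_add' := by intro a b; funext y; simp; ring
      map_smul' := by intro a b; funext y; simp; ring
      isIntertwining' := by
        intro g; apply LinearMap.ext; intro F; funext y
        change F (y.1, g⁻¹ * (y.2 * σ y.1)) - F (y.1, g⁻¹ * y.2) =
          F (y.1, (g⁻¹ * y.2) * σ y.1) - F (y.1, g⁻¹ * y.2)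
        rw [mul_assoc] }
  let f2 : ρY.IntertwiningMap ρX :=
    { toFun := fun F x => ∑ u : S (q x), F (q x, τ x * u)
      map_add' := by intro a b; funext y; simp [Finset.sum_add_distrib]
      map_smul' := by intro a b; funext y; simp [Finset.mul_sum]
      isIntertwining' := by
        intro g; apply LinearMap.ext; intro F; funext x
        change ∑ u : S (q x), F (q x, g⁻¹ * (τ x * u)) =
          ∑ u : S (q (g⁻¹ • x)), F (q (g⁻¹ • x), τ (g⁻¹ • x) * u)
        have key : ∀ ω (_ : ω = q x), ∑ u : S (q x), F (q x, g⁻¹ * (τ x * u)) =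
          ∑ u : S ω, F (ω, τ (g⁻¹ • x) * u) := by
          rintro _ rfl
          simp only [← mul_assoc]
          apply hsum
          rw [mul_smul, hτ]
          conv_lhs => rw [← hτ (g⁻¹ • x)]
          rw [hq]
        exact key _ (hq _ _) }
  have hB : ∀ n, IsZero (groupCohomology (Rep.of ρY) (n + 1)) := by
    intro n
    let e : (Y → ℤ) →ₗ[ℤ] (Ω → ℤ) := LinearMap.funLeft ℤ ℤ (fun ω => (ω, 1))
    refine acyclic_of_bij ρY e ⟨?_, ?_⟩ n
    · intro a b hab
      funext y
      have := congrFun (congrFun hab y.2⁻¹) y.1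
      change a (y.1, y.2⁻¹⁻¹ * 1) = b (y.1, y.2⁻¹⁻¹ * 1) at this
      simpa using this
    · intro F
      refine ⟨fun y => F y.2⁻¹ y.1, ?_⟩
      funext g ω
      change F (g⁻¹ * 1)⁻¹ ω = _
      simp
  have hinv : ∀ (F : Y → ℤ), f1 F = 0 → ∀ ω (h : G) (u : S ω), F (ω, h * u) = F (ω, h) := by
    intro F hF ω h u
    have h1 : ∀ h : G, F (ω, h * σ ω) = F (ω, h) := fun h =>
      sub_eq_zero.1 (congrFun hF (ω, h))
    have h2 : ∀ (n : ℕ) (h : G), F (ω, h * σ ω ^ n) = F (ω, h) := by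
      intro n
      induction n with
      | zero => simp
      | succ n ih => intro h; rw [pow_succ, ← mul_assoc, h1, ih]
    have := (mem_zpowers_iff_mem_range_orderOf (x := σ ω) (y := u)).1 (hσ ω u)
    obtain ⟨n, -, hn⟩ := Finset.mem_image.1 this
    rw [← hn]
    simpa using h2 n h
  refine periodic_shift (A := Rep.of ρX) (B := Rep.of ρY) (Rep.ofHom f0) (Rep.ofHom f1)
    (Rep.ofHom f2) ?_ ?_ ?_ ?_ ?_ ?_ hB m
  · intro a b hab
    funext x
    have := congrFun hab (q x, τ x)
    change a (τ x • r (q x)) = b (τ x • r (q x)) at this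
    rwa [hτ] at this
  · ext f y
    change f ((y.2 * σ y.1) • r y.1) - f (y.2 • r y.1) = 0
    rw [mul_smul, (σ y.1).2, sub_self]
  · ext F x
    change ∑ u : S (q x), (F (q x, (τ x * u) * σ (q x)) - F (q x, τ x * u)) = 0
    rw [Finset.sum_sub_distrib, sub_eq_zero]
    refine Fintype.sum_equiv (Equiv.mulRight (σ (q x))) _ _ ?_
    intro u
    simp [mul_assoc]
  · intro F hF
    refine ⟨fun x => F (q x, τ x), ?_⟩
    funext y
    obtain ⟨ω, h⟩ := y
    change F (q (h • r ω), τ (h • r ω)) = F (ω, h)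
    have h1 : τ (h • r ω) • r ω = h • r ω := by
      conv_rhs => rw [← hτ (h • r ω)]
      rw [hqh]
    rw [hqh]
    have hv : h⁻¹ * τ (h • r ω) ∈ S ω := by
      change (h⁻¹ * τ (h • r ω)) • r ω = r ω
      rw [mul_smul, h1, inv_smul_smul]
    have := hinv F hF ω h ⟨_, hv⟩
    simpa using this
  · intro F hF
    have hs : ∀ x, ∃ g : S (q x) → ℤ, ∀ u, g (u * σ (q x)) - g u = F (q x, τ x * u) := by
      intro x
      exact cyclic_solve (σ (q x)) (hσ (q x)) _ (congrFun hF x)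
    have hs' : ∀ (ω : Ω) (x : X), ∃ g : G → ℤ, q x = ω → ∀ u ∈ S ω,
        g (u * σ ω) - g u = F (ω, τ x * u) := by
      intro ω x
      by_cases hx : q x = ω
      · subst hx
        obtain ⟨g, hg⟩ := hs x
        refine ⟨fun u => if hu : u ∈ S (q x) then g ⟨u, hu⟩ else 0, fun _ u hu => ?_⟩
        have := hg ⟨u, hu⟩
        have h2 : u * σ (q x) ∈ S (q x) := mul_mem hu (σ (q x)).2
        simp only [hu, h2, dif_pos]
        exact this
      · exact ⟨0, fun h => absurd h hx⟩
    choose g hg using hs'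
    refine ⟨fun y => g y.1 (y.2 • r y.1) ((τ (y.2 • r y.1))⁻¹ * y.2), ?_⟩
    funext y
    obtain ⟨ω, h⟩ := y
    change g ω ((h * σ ω) • r ω) ((τ ((h * σ ω) • r ω))⁻¹ * (h * σ ω)) -
      g ω (h • r ω) ((τ (h • r ω))⁻¹ * h) = F (ω, h)
    have e1 : (h * σ ω) • r ω = h • r ω := by rw [mul_smul, (σ ω).2]
    have h1 : τ (h • r ω) • r ω = h • r ω := by
      conv_rhs => rw [← hτ (h • r ω)]
      rw [hqh]
    have := hg ω (h • r ω) (hqh _ _) ((τ (h • r ω))⁻¹ * h) (by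
      change ((τ (h • r ω))⁻¹ * h) • r ω = r ω
      rw [mul_smul, inv_smul_eq_iff, h1])
    rw [e1, ← mul_assoc, this, mul_inv_cancel_left]
  · intro f
    refine ⟨fun y => if y.2 = τ (y.2 • r y.1) then f (y.2 • r y.1) else 0, ?_⟩
    funext x
    change ∑ u : S (q x), (if τ x * u = τ ((τ x * u) • r (q x)) then
      f ((τ x * u) • r (q x)) else 0) = f x
    have e : ∀ u : S (q x), (τ x * u) • r (q x) = x := by
      intro u
      rw [mul_smul, u.2, hτ]
    simp only [e]
    rw [Finset.sum_eq_single 1]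
    · simp
    · intro u _ hu
      rw [if_neg]
      intro h
      apply hu
      simpa using h
    · simp

/-! ### Cutting into cells -/

section cells
variable {X P I : Type} [AddCommGroup P]

lemma cells_indep (N : Set X → Submodule ℤ P) (mono : Monotone N) (H : I → I → Set X)
    (cut : ∀ K i j, i ≠ j → N K ≤ N (K ∩ H i j) ⊔ N (K ∩ H j i))
    (disj : ∀ i j, i ≠ j → ∀ z, z ∈ N (H i j) → z ∈ N (H j i) → z = 0)
    (i0 : I) (S : Finset I) : i0 ∉ S → ∀ z : I → P, (∀ l, z l ∈ N (⋂ j, H l j)) →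
    z i0 + ∑ l ∈ S, z l = 0 → z i0 = 0 := by
  classical
  induction S using Finset.induction_on with
  | empty => intro _ z _ h; simpa using h
  | insert j S hj ih =>
    intro hi z hz h
    have hne : i0 ≠ j := by rintro rfl; simp at hi
    have hiS : i0 ∉ S := fun h => hi (Finset.mem_insert_of_mem h)
    have hsp : ∀ l, ∃ a b, a ∈ N ((⋂ k, H l k) ∩ H i0 j) ∧ b ∈ N ((⋂ k, H l k) ∩ H j i0) ∧
        a + b = z l := by
      intro l
      obtain ⟨a, ha, b, hb, hab⟩ := Submodule.mem_sup.1 (cut _ i0 j hne (hz l))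
      exact ⟨a, b, ha, hb, hab⟩
    choose a b ha hb hab using hsp
    have hi0 : z i0 ∈ N (H i0 j) := mono (Set.iInter_subset _ j) (hz i0)
    have hjj : z j ∈ N (H j i0) := mono (Set.iInter_subset _ i0) (hz j)
    have key : z i0 + ∑ l ∈ S, a l = 0 := by
      refine disj i0 j hne _ ?_ ?_
      · exact add_mem hi0 (sum_mem fun l _ => mono Set.inter_subset_right (ha l))
      · have : z i0 + ∑ l ∈ S, a l = - (z j + ∑ l ∈ S, b l) := by
          rw [Finset.sum_insert hj] at h
          have h2 : ∑ l ∈ S, z l = ∑ l ∈ S, a l + ∑ l ∈ S, b l := by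
            rw [← Finset.sum_add_distrib]
            exact Finset.sum_congr rfl fun l _ => (hab l).symm
          rw [h2] at h
          rw [eq_neg_iff_add_eq_zero, ← h]
          abel
        rw [this]
        exact neg_mem (add_mem hjj (sum_mem fun l _ => mono Set.inter_subset_right (hb l)))
    have := ih hiS (fun l => if l = i0 then z i0 else a l) (by
      intro l
      by_cases hl : l = i0
      · subst hl; simpa using hz l
      · simpa [hl] using mono Set.inter_subset_left (ha l)) (by
      simp only [if_true]
      rw [← key]
      congr 1
      refine Finset.sum_congr rfl fun l hl => ?_
      rw [if_neg]
      rintro rfl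
      exact hiS hl)
    simpa using this

lemma cells_span (N : Set X → Submodule ℤ P) (mono : Monotone N) (H : I → I → Set X)
    (refl : ∀ i x, x ∈ H i i) (trans : ∀ i j k x, x ∈ H i j → x ∈ H j k → x ∈ H i k)
    (cut : ∀ K i j, i ≠ j → N K ≤ N (K ∩ H i j) ⊔ N (K ∩ H j i)) (K : Set X)
    (J : Finset I) (hJ : J.Nonempty) :
    N K ≤ ⨆ i ∈ J, N (K ∩ {x | ∀ j ∈ J, x ∈ H i j}) := by
  classical
  induction hJ using Finset.Nonempty.cons_induction with
  | singleton i =>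
    refine le_trans (mono ?_) (le_iSup₂_of_le i (by simp) le_rfl)
    intro x hx
    exact ⟨hx, by simpa using refl i x⟩
  | cons j J hj hne ih =>
    refine ih.trans (iSup₂_le fun i hi => ?_)
    have hij : i ≠ j := by rintro rfl; exact hj hi
    refine (cut _ i j hij).trans (sup_le ?_ ?_)
    · refine le_trans (mono ?_) (le_iSup₂_of_le i (by simp [hi]) le_rfl)
      rintro x ⟨⟨h1, h2⟩, h3⟩
      refine ⟨h1, fun k hk => ?_⟩
      rcases Finset.mem_cons.1 hk with rfl | hk
      · exact h3
      · exact h2 k hk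
    · refine le_trans (mono ?_) (le_iSup₂_of_le j (by simp) le_rfl)
      rintro x ⟨⟨h1, h2⟩, h3⟩
      refine ⟨h1, fun k hk => ?_⟩
      rcases Finset.mem_cons.1 hk with rfl | hk
      · exact refl _ _
      · exact trans _ _ _ _ h3 (h2 k hk)

end cells

lemma acyclic_of_cells {X P : Type} [AddCommGroup P] [MulAction G X]
    (ρ : Representation ℤ G P)
    (N : Set X → Submodule ℤ P) (mono : Monotone N) (H : G → G → Set X)
    (refl : ∀ i x, x ∈ H i i) (trans : ∀ i j k x, x ∈ H i j → x ∈ H j k → x ∈ H i k)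
    (cut : ∀ K i j, i ≠ j → N K ≤ N (K ∩ H i j) ⊔ N (K ∩ H j i))
    (disj : ∀ i j, i ≠ j → ∀ z, z ∈ N (H i j) → z ∈ N (H j i) → z = 0)
    (equiv : ∀ g K z, z ∈ N K → ρ g z ∈ N {x | g⁻¹ • x ∈ K})
    (Hequiv : ∀ g i j x, x ∈ H i j → g • x ∈ H (g * i) (g * j))
    (S : Set P) (hS : Submodule.span ℤ S = ⊤)
    (hfin : ∀ s ∈ S, ∃ (K : Set X) (J : Set G) (i : G), J.Finite ∧ i ∈ J ∧ s ∈ N K ∧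
      ∀ j ∉ J, K ⊆ H i j) (n : ℕ) :
    IsZero (groupCohomology (Rep.of ρ.dual) (n + 1)) := by
  classical
  let D : G → Set X := fun i => ⋂ j, H i j
  have hD : ∀ g i, {x | g⁻¹ • x ∈ D i} = D (g * i) := by
    intro g i
    ext x
    simp only [D, Set.mem_iInter, Set.mem_ofPred_eq]
    constructor
    · intro h j
      have := Hequiv g _ _ _ (h (g⁻¹ * j))
      simpa using this
    · intro h j
      have := Hequiv g⁻¹ _ _ _ (h (g * j))
      simpa using this
  let N1 := N (D 1)
  let Φ : (G →₀ N1) →ₗ[ℤ] P := Finsupp.lsum ℤ (fun g => (ρ g⁻¹) ∘ₗ N1.subtype)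
  have hΦs : ∀ g (z : N1), Φ (Finsupp.single g z) = ρ g⁻¹ z := by
    intro g z
    simp [Φ]
  have hmem : ∀ g (z : N1), ρ g z ∈ N (D g) := by
    intro g z
    have := equiv g _ _ z.2
    rwa [hD, mul_one] at this
  have hinj : Function.Injective Φ := by
    rw [injective_iff_map_eq_zero]
    intro a ha
    ext g
    have h1 : Φ a = ∑ g ∈ a.support, ρ g⁻¹ (a g) := by
      simp [Φ, Finsupp.sum]
    let z : G → P := fun i => ρ i (a i⁻¹)
    have hz : ∀ l, z l ∈ N (⋂ j, H l j) := fun l => hmem l _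
    by_cases hg : g ∈ a.support
    · have h2 : z g⁻¹ + ∑ l ∈ (a.support.erase g).image (fun x => x⁻¹), z l = 0 := by
        rw [Finset.sum_image (fun x _ y _ h => inv_injective h)]
        simp only [z, inv_inv]
        rw [Finset.add_sum_erase _ (fun g => ρ g⁻¹ (a g : P)) hg, ← h1, ha]
      have h3 := cells_indep N mono H cut disj g⁻¹ _ (by simp) z hz h2
      have h4 : ρ g (z g⁻¹) = a g := by
        simp only [z, inv_inv]
        rw [← Module.End.mul_apply, ← map_mul]; simp
      rw [← h4, h3]; simp
    · simpa using hg
  have hsurj : Function.Surjective Φ := by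
    rw [← LinearMap.range_eq_top, eq_top_iff, ← hS, Submodule.span_le]
    intro s hs
    obtain ⟨K, J, i, hJ, hi, hsK, hK⟩ := hfin s hs
    have h1 := cells_span N mono H refl trans cut K hJ.toFinset ⟨i, by simpa using hi⟩ hsK
    have h2 : (⨆ i ∈ hJ.toFinset, N (K ∩ {x | ∀ j ∈ hJ.toFinset, x ∈ H i j})) ≤
        LinearMap.range Φ := by
      refine iSup₂_le fun l hl => ?_
      have h3 : N (K ∩ {x | ∀ j ∈ hJ.toFinset, x ∈ H l j}) ≤ N (D l) := by
        apply mono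
        rintro x ⟨hx, hx2⟩
        simp only [D, Set.mem_iInter]
        intro j
        by_cases hj : j ∈ J
        · exact hx2 j (by simpa using hj)
        · exact trans _ _ _ _ (hx2 i (by simpa using hi)) (hK j hj hx)
      refine h3.trans fun z hz => ?_
      have h4 : ρ l⁻¹ z ∈ N1 := by
        have := equiv l⁻¹ _ _ hz
        rwa [hD, inv_mul_cancel] at this
      refine ⟨Finsupp.single l⁻¹ ⟨_, h4⟩, ?_⟩
      rw [hΦs, ← Module.End.mul_apply, ← map_mul]; simp
    exact h2 h1
  let e : Module.Dual ℤ P →ₗ[ℤ] Module.Dual ℤ N1 := Module.Dual.transpose N1.subtype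
  refine acyclic_of_bij ρ.dual e ?_ n
  have hval : ∀ (a : Module.Dual ℤ P) (g : G) (z : N1), e (ρ.dual g a) z = a (ρ g⁻¹ z) :=
    fun a g z => rfl
  constructor
  · intro a b hab
    apply LinearMap.ext
    intro p
    obtain ⟨c, rfl⟩ := hsurj p
    have : a ∘ₗ Φ = b ∘ₗ Φ := by
      apply Finsupp.lhom_ext
      intro g z
      rw [LinearMap.comp_apply, LinearMap.comp_apply, hΦs, ← hval, ← hval]
      exact LinearMap.congr_fun (congrFun hab g) z
    exact LinearMap.congr_fun this c
  · intro F
    let E := LinearEquiv.ofBijective Φ ⟨hinj, hsurj⟩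
    refine ⟨(Finsupp.lsum ℤ F) ∘ₗ E.symm.toLinearMap, ?_⟩
    funext g
    apply LinearMap.ext
    intro z
    simp only [hval]
    have : E.symm (ρ g⁻¹ z) = Finsupp.single g z := by
      rw [LinearEquiv.symm_apply_eq]
      exact (hΦs g z).symm
    rw [LinearMap.comp_apply, LinearEquiv.coe_coe, this]
    simp

/-! ### Segments -/

/-- A set with an injective chart to the plane with convex image. -/
class Chart (X : Type) where
  κ : X → ℝ × ℝ
  inj : Function.Injective κ
  conv : ∀ a b : X, ∀ t : ℝ, 0 ≤ t → t ≤ 1 → ∃ c, κ c = AffineMap.lineMap (κ a) (κ b) t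

section chart
variable {X : Type} [Chart X]
open Chart

/-- betweenness -/
def bt (a x b : X) : Prop := Wbtw ℝ (κ a) (κ x) (κ b)

/-- strict betweenness -/
def sb (a x b : X) : Prop := bt a x b ∧ x ≠ a ∧ x ≠ b

/-- affine functions -/
def IsAff (f : X → ℝ) : Prop := ∃ F : (ℝ × ℝ) →ᵃ[ℝ] ℝ, ∀ x, f x = F (κ x)

lemma IsAff.neg {f : X → ℝ} (hf : IsAff f) : IsAff (-f) := by
  obtain ⟨F, hF⟩ := hf
  exact ⟨-F, fun x => by simp [hF]⟩

lemma IsAff.line {f : X → ℝ} (hf : IsAff f) {a x b : X} {t : ℝ}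
    (h : κ x = AffineMap.lineMap (κ a) (κ b) t) : f x = f a + t * (f b - f a) := by
  obtain ⟨F, hF⟩ := hf
  rw [hF, h, AffineMap.apply_lineMap, ← hF, ← hF, AffineMap.lineMap_apply]
  simp
  ring

lemma bt_param {a x b : X} (h : bt a x b) :
    ∃ t : ℝ, 0 ≤ t ∧ t ≤ 1 ∧ κ x = AffineMap.lineMap (κ a) (κ b) t := by
  obtain ⟨t, ht, h⟩ := h
  exact ⟨t, ht.1, ht.2, h.symm⟩

lemma bt_of_param {a x b : X} {t : ℝ} (h0 : 0 ≤ t) (h1 : t ≤ 1)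
    (h : κ x = AffineMap.lineMap (κ a) (κ b) t) : bt a x b := ⟨t, ⟨h0, h1⟩, h.symm⟩

lemma sb_param {a x b : X} (h : sb a x b) :
    ∃ t : ℝ, 0 < t ∧ t < 1 ∧ κ x = AffineMap.lineMap (κ a) (κ b) t := by
  obtain ⟨t, h0, h1, hx⟩ := bt_param h.1
  refine ⟨t, lt_of_le_of_ne h0 ?_, lt_of_le_of_ne h1 ?_, hx⟩
  · rintro rfl
    exact h.2.1 (inj (by simpa using hx))
  · rintro rfl
    exact h.2.2 (inj (by simpa using hx))

lemma exists_sb {a b : X} (hab : a ≠ b) {t : ℝ} (h0 : 0 < t) (h1 : t < 1) :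
    ∃ x, sb a x b ∧ κ x = AffineMap.lineMap (κ a) (κ b) t := by
  obtain ⟨x, hx⟩ := conv a b t h0.le h1.le
  have hk : κ a ≠ κ b := fun h => hab (inj h)
  refine ⟨x, ⟨bt_of_param h0.le h1.le hx, ?_, ?_⟩, hx⟩
  · rintro rfl
    have := AffineMap.lineMap_injective ℝ hk (a₁ := 0) (a₂ := t) (by simpa using hx)
    exact h0.ne this
  · rintro rfl
    have := AffineMap.lineMap_injective ℝ hk (a₁ := 1) (a₂ := t) (by simpa using hx)
    exact h1.ne' this

lemma bt_comm {a x b : X} : bt a x b ↔ bt b x a := wbtw_comm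

lemma bt_left (a b : X) : bt a a b := wbtw_self_left ℝ _ _
lemma bt_right (a b : X) : bt a b b := wbtw_self_right ℝ _ _

lemma bt_aff {f : X → ℝ} (hf : IsAff f) {a x b : X} (h : bt a x b) :
    ∃ t : ℝ, 0 ≤ t ∧ t ≤ 1 ∧ f x = f a + t * (f b - f a) := by
  obtain ⟨t, h0, h1, hx⟩ := bt_param h
  exact ⟨t, h0, h1, hf.line hx⟩

lemma bt_nonneg {f : X → ℝ} (hf : IsAff f) {a x b : X} (h : bt a x b) (ha : 0 ≤ f a)
    (hb : 0 ≤ f b) : 0 ≤ f x := by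
  obtain ⟨t, h0, h1, e⟩ := bt_aff hf h
  rw [e]; nlinarith [mul_nonneg h0 hb, mul_nonneg (sub_nonneg.2 h1) ha]

lemma bt_nonpos {f : X → ℝ} (hf : IsAff f) {a x b : X} (h : bt a x b) (ha : f a ≤ 0)
    (hb : f b ≤ 0) : f x ≤ 0 := by
  have := bt_nonneg hf.neg h (by simpa using ha) (by simpa using hb)
  simpa using this

lemma bt_pos {f : X → ℝ} (hf : IsAff f) {a x b : X} (h : bt a x b) (ha : 0 < f a)
    (hb : 0 < f b) : 0 < f x := by
  obtain ⟨t, h0, h1, e⟩ := bt_aff hf h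
  rw [e]
  rcases h0.eq_or_lt with rfl | h0
  · simpa using ha
  · nlinarith [mul_pos h0 hb, mul_nonneg (sub_nonneg.2 h1) ha.le]

lemma sb_pos {f : X → ℝ} (hf : IsAff f) {a x b : X} (h : sb a x b) (ha : 0 ≤ f a)
    (hb : 0 ≤ f b) (hab : 0 < f a ∨ 0 < f b) : 0 < f x := by
  obtain ⟨t, h0, h1, hx⟩ := sb_param h
  rw [hf.line hx]
  rcases hab with h | h
  · nlinarith [mul_nonneg h0.le hb, mul_pos (sub_pos.2 h1) h]
  · nlinarith [mul_pos h0 h, mul_nonneg (sub_nonneg.2 h1.le) ha]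

lemma exists_cross {f : X → ℝ} (hf : IsAff f) {a b : X} (h : f a * f b ≤ 0) :
    ∃ x, bt a x b ∧ f x = 0 := by
  by_cases hab : f a = f b
  · exact ⟨a, bt_left a b, by rw [← hab] at h; nlinarith [mul_self_nonneg (f a)]⟩
  have hne : f a - f b ≠ 0 := sub_ne_zero.2 hab
  have hsq : 0 < (f a - f b) ^ 2 := by positivity
  have h0 : 0 ≤ f a / (f a - f b) := by
    have : f a / (f a - f b) = (f a * f a - f a * f b) / (f a - f b) ^ 2 := by
      field_simp
    rw [this]
    apply div_nonneg _ hsq.le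
    nlinarith [mul_self_nonneg (f a)]
  have h1 : 0 ≤ 1 - f a / (f a - f b) := by
    have : 1 - f a / (f a - f b) = (f b * f b - f a * f b) / (f a - f b) ^ 2 := by
      field_simp
      ring
    rw [this]
    apply div_nonneg _ hsq.le
    nlinarith [mul_self_nonneg (f b)]
  obtain ⟨x, hx⟩ := conv a b _ h0 (by linarith)
  refine ⟨x, bt_of_param h0 (by linarith) hx, ?_⟩
  rw [hf.line hx]
  field_simp
  ring

lemma cross_unique {f : X → ℝ} (hf : IsAff f) {a b x y : X} (hne : f a ≠ f b)
    (hx : bt a x b) (hy : bt a y b) (hxy : f x = f y) : x = y := by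
  obtain ⟨t, -, -, ht⟩ := bt_param hx
  obtain ⟨s, -, -, hs⟩ := bt_param hy
  have h1 := hf.line ht
  have h2 := hf.line hs
  have : t = s := by
    have : (t - s) * (f b - f a) = 0 := by linarith
    rcases mul_eq_zero.1 this with h | h
    · linarith
    · exact absurd (by linarith) hne
  subst this
  exact inj (ht.trans hs.symm)

open Classical in
/-- the crossing point -/
noncomputable def cr (f : X → ℝ) (a b : X) : X :=
  if h : ∃ x, bt a x b ∧ f x = 0 then h.choose else a

lemma cr_spec {f : X → ℝ} (hf : IsAff f) {a b : X} (h : f a * f b ≤ 0) :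
    bt a (cr f a b) b ∧ f (cr f a b) = 0 := by
  have := exists_cross hf h
  rw [cr, dif_pos this]
  exact this.choose_spec

lemma cr_eq {f : X → ℝ} (hf : IsAff f) {a b x : X} (h : f a * f b ≤ 0) (hne : f a ≠ f b)
    (hx : bt a x b) (h0 : f x = 0) : cr f a b = x :=
  cross_unique hf hne (cr_spec hf h).1 hx ((cr_spec hf h).2.trans h0.symm)

/-- the relations between segments -/
def segRel (X : Type) [Chart X] : Set (FreeAbelianGroup (X × X)) :=
  {r | (∃ a b c : X, bt a b c ∧ r = FreeAbelianGroup.of (a, b) + FreeAbelianGroup.of (b, c) -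
      FreeAbelianGroup.of (a, c)) ∨
    ∃ a b : X, r = FreeAbelianGroup.of (a, b) + FreeAbelianGroup.of (b, a)}

/-- the group of segments -/
def P1 (X : Type) [Chart X] : Type :=
  FreeAbelianGroup (X × X) ⧸ AddSubgroup.closure (segRel X)

noncomputable instance : AddCommGroup (P1 X) :=
  inferInstanceAs (AddCommGroup (FreeAbelianGroup (X × X) ⧸ AddSubgroup.closure (segRel X)))

/-- a segment -/
def seg (a b : X) : P1 X :=
  QuotientAddGroup.mk' (AddSubgroup.closure (segRel X)) (FreeAbelianGroup.of (a, b))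

lemma seg_add {a b c : X} (h : bt a b c) : seg a b + seg b c = seg a c := by
  have : QuotientAddGroup.mk' (AddSubgroup.closure (segRel X)) (FreeAbelianGroup.of (a, b) +
      FreeAbelianGroup.of (b, c) - FreeAbelianGroup.of (a, c)) = 0 :=
    (QuotientAddGroup.eq_zero_iff _).2 (AddSubgroup.subset_closure (Or.inl ⟨a, b, c, h, rfl⟩))
  rw [map_sub, map_add, sub_eq_zero] at this
  exact this

lemma seg_symm (a b : X) : seg b a = - seg a b := by
  have : QuotientAddGroup.mk' (AddSubgroup.closure (segRel X)) (FreeAbelianGroup.of (a, b) +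
      FreeAbelianGroup.of (b, a)) = 0 :=
    (QuotientAddGroup.eq_zero_iff _).2 (AddSubgroup.subset_closure (Or.inr ⟨a, b, rfl⟩))
  rw [map_add] at this
  exact (neg_eq_of_add_eq_zero_right this).symm

lemma seg_self (a : X) : seg a a = 0 := by
  have := seg_add (bt_left a a)
  simpa using this

/-- lifting maps to the group of segments -/
def P1lift {B : Type} [AddCommGroup B] (φ : X → X → B)
    (h1 : ∀ a b c, bt a b c → φ a b + φ b c = φ a c) (h2 : ∀ a b, φ a b + φ b a = 0) :
    P1 X →ₗ[ℤ] B :=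
  (QuotientAddGroup.lift (AddSubgroup.closure (segRel X))
    (FreeAbelianGroup.lift (fun p : X × X => φ p.1 p.2)) (by
      rw [AddSubgroup.closure_le]
      rintro r (⟨a, b, c, h, rfl⟩ | ⟨a, b, rfl⟩)
      · change FreeAbelianGroup.lift (fun p : X × X => φ p.1 p.2) _ = 0
        simp [h1 a b c h]
      · change FreeAbelianGroup.lift (fun p : X × X => φ p.1 p.2) _ = 0
        simp [h2]) : P1 X →+ B).toIntLinearMap

lemma P1lift_seg {B : Type} [AddCommGroup B] (φ : X → X → B) (h1) (h2) (a b : X) :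
    P1lift φ h1 h2 (seg a b) = φ a b :=
  FreeAbelianGroup.lift_apply_of (fun p : X × X => φ p.1 p.2) (a, b)

lemma span_seg : Submodule.span ℤ {z : P1 X | ∃ a b, z = seg a b} = ⊤ := by
  rw [eq_top_iff]
  rintro z -
  obtain ⟨w, rfl⟩ := QuotientAddGroup.mk'_surjective _ z
  induction w using FreeAbelianGroup.induction_on with
  | zero => rw [map_zero]; exact zero_mem _
  | of x => exact Submodule.subset_span ⟨x.1, x.2, rfl⟩
  | neg x h => rw [map_neg]; exact neg_mem h
  | add x y hx hy => rw [map_add]; exact add_mem hx hy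

lemma P1_ext {B : Type} [AddCommGroup B] {φ ψ : P1 X →ₗ[ℤ] B}
    (h : ∀ a b, φ (seg a b) = ψ (seg a b)) : φ = ψ := by
  apply LinearMap.ext_on span_seg
  rintro _ ⟨a, b, rfl⟩
  exact h a b

open Classical in
/-- the positive part of a segment -/
noncomputable def sgfun (f : X → ℝ) (a b : X) : P1 X :=
  if 0 < f a then (if 0 < f b then seg a b else seg a (cr f a b))
  else (if 0 < f b then seg (cr f a b) b else 0)

/-- the positive part operator -/
noncomputable def sg (f : X → ℝ) (hf : IsAff f) : P1 X →ₗ[ℤ] P1 X :=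
  P1lift (sgfun f) (by
    intro a b c h
    by_cases ha : 0 < f a <;> by_cases hb : 0 < f b <;> by_cases hc : 0 < f c <;>
      simp only [sgfun, ha, hb, hc, if_true, if_false]
    · exact seg_add h
    · have hx := cr_spec hf (a := b) (b := c) (by nlinarith)
      have e : cr f a c = cr f b c :=
        cr_eq hf (by nlinarith) (by linarith) (Wbtw.trans_right h hx.1) hx.2
      rw [e]
      exact seg_add (Wbtw.trans_right_left h hx.1)
    · exact absurd (bt_pos hf h ha hc) hb
    · have hx := cr_spec hf (a := a) (b := b) (by nlinarith)
      have e : cr f a c = cr f a b :=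
        cr_eq hf (by nlinarith) (by linarith) (Wbtw.trans_left h hx.1) hx.2
      rw [e, add_zero]
    · have hx := cr_spec hf (a := a) (b := b) (by nlinarith)
      have e : cr f a c = cr f a b :=
        cr_eq hf (by nlinarith) (by linarith) (Wbtw.trans_left h hx.1) hx.2
      rw [e]
      exact seg_add (Wbtw.trans_left_right h hx.1)
    · exact absurd (bt_nonpos hf h (not_lt.1 ha) (not_lt.1 hc)) (not_le.2 hb)
    · have hx := cr_spec hf (a := b) (b := c) (by nlinarith)
      have e : cr f a c = cr f b c :=
        cr_eq hf (by nlinarith) (by linarith) (Wbtw.trans_right h hx.1) hx.2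
      rw [e, zero_add]
    · simp) (by
    intro a b
    by_cases ha : 0 < f a <;> by_cases hb : 0 < f b <;>
      simp only [sgfun, ha, hb, if_true, if_false]
    · rw [seg_symm a b]; simp
    · have hx := cr_spec hf (a := a) (b := b) (by nlinarith)
      rw [cr_eq hf (a := b) (b := a) (by nlinarith) (by linarith) (bt_comm.1 hx.1) hx.2,
        seg_symm a]
      simp
    · have hx := cr_spec hf (a := a) (b := b) (by nlinarith)
      rw [cr_eq hf (a := b) (b := a) (by nlinarith) (by linarith) (bt_comm.1 hx.1) hx.2,
        seg_symm b]
      simp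
    · simp)

lemma sg_seg {f : X → ℝ} (hf : IsAff f) (a b : X) : sg f hf (seg a b) = sgfun f a b :=
  P1lift_seg _ _ _ _ _

lemma sg_nonpos {f : X → ℝ} (hf : IsAff f) {a b : X} (ha : f a ≤ 0) (hb : f b ≤ 0) :
    sg f hf (seg a b) = 0 := by
  rw [sg_seg, sgfun, if_neg (not_lt.2 ha), if_neg (not_lt.2 hb)]

lemma sg_pos {f : X → ℝ} (hf : IsAff f) {a b : X} (ha : 0 ≤ f a) (hb : 0 ≤ f b)
    (hab : 0 < f a ∨ 0 < f b) : sg f hf (seg a b) = seg a b := by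
  rw [sg_seg, sgfun]
  by_cases h1 : 0 < f a
  · rw [if_pos h1]
    by_cases h2 : 0 < f b
    · rw [if_pos h2]
    · rw [if_neg h2, cr_eq hf (by nlinarith) (by linarith) (bt_right a b) (by linarith)]
  · have h2 : 0 < f b := by tauto
    rw [if_neg h1, if_pos h2, cr_eq hf (by nlinarith) (by linarith) (bt_left a b) (by linarith)]

/-- splitting a segment into pieces where an affine function has constant sign -/
lemma split_seg {f : X → ℝ} (hf : IsAff f) (Q : Submodule ℤ (P1 X)) (a b : X)
    (h : ∀ a' b', bt a a' b → bt a b' b → (0 ≤ f a' ∧ 0 ≤ f b') ∨ (f a' ≤ 0 ∧ f b' ≤ 0) →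
      seg a' b' ∈ Q) : seg a b ∈ Q := by
  by_cases hab : f a * f b ≤ 0
  · obtain ⟨x, hx, hx0⟩ := exists_cross hf hab
    rw [← seg_add hx]
    refine add_mem (h _ _ (bt_left _ _) hx ?_) (h _ _ hx (bt_right _ _) ?_)
    · rw [hx0]; simpa using le_total _ _
    · rw [hx0]; simpa using le_total _ _
  · refine h _ _ (bt_left _ _) (bt_right _ _) ?_
    push Not at hab
    rcases pos_and_pos_or_neg_and_neg_of_mul_pos hab with h | h
    · exact Or.inl ⟨h.1.le, h.2.le⟩
    · exact Or.inr ⟨h.1.le, h.2.le⟩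

end chart

section lex
variable {X : Type} [Chart X]
open Chart

lemma sb_trans {a b a' b' x : X} (ha : bt a a' b) (hb : bt a b' b) (h : sb a' x b') :
    sb a x b := by
  obtain ⟨s, s0, s1, hs⟩ := bt_param ha
  obtain ⟨u, u0, u1, hu⟩ := bt_param hb
  obtain ⟨t, t0, t1, ht⟩ := sb_param h
  have hne : a' ≠ b' := by
    rintro rfl
    apply h.2.1
    apply inj
    simpa using ht
  have hsu : s ≠ u := by
    rintro rfl
    exact hne (inj (hs.trans hu.symm))
  have hab : a ≠ b := by
    rintro rfl
    apply hne
    apply inj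
    rw [hs, hu]; simp
  have hx : κ x = AffineMap.lineMap (κ a) (κ b) (s + t * (u - s)) := by
    rw [ht, hs, hu]
    simp only [AffineMap.lineMap_apply_module']
    module
  have h0 : 0 < s + t * (u - s) := by
    rcases lt_or_gt_of_ne hsu with h | h
    · nlinarith
    · nlinarith [mul_pos (sub_pos.2 t1) (lt_of_le_of_lt u0 h), mul_nonneg t0.le u0]
  have h1 : s + t * (u - s) < 1 := by
    rcases lt_or_gt_of_ne hsu with h | h
    · nlinarith [mul_pos (sub_pos.2 t1) (sub_pos.2 (lt_of_lt_of_le h u1)),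
        mul_nonneg t0.le (sub_nonneg.2 u1)]
    · nlinarith
  obtain ⟨y, hy, hy2⟩ := exists_sb hab h0 h1
  have : x = y := inj (hx.trans hy2.symm)
  rwa [this]

lemma end_nonneg {f : X → ℝ} (hf : IsAff f) {a b : X} (hab : a ≠ b)
    (h : ∀ x, sb a x b → 0 ≤ f x) : 0 ≤ f a ∧ 0 ≤ f b := by
  constructor
  · by_contra hc
    push Not at hc
    set t : ℝ := min (1 / 2) (- f a / (2 * (|f b - f a| + 1))) with ht
    have hd : 0 < 2 * (|f b - f a| + 1) := by positivity
    have t0 : 0 < t := lt_min (by norm_num) (div_pos (by linarith) hd)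
    have t1 : t < 1 := lt_of_le_of_lt (min_le_left _ _) (by norm_num)
    have t2 : t * (2 * (|f b - f a| + 1)) ≤ - f a := by
      rw [← le_div_iff₀ hd]; exact min_le_right _ _
    obtain ⟨x, hx, hx2⟩ := exists_sb hab t0 t1
    have h1 := h x hx
    rw [hf.line hx2] at h1
    have := mul_le_mul_of_nonneg_left (le_abs_self (f b - f a)) t0.le
    nlinarith
  · by_contra hc
    push Not at hc
    set t : ℝ := min (1 / 2) (- f b / (2 * (|f b - f a| + 1))) with ht
    have hd : 0 < 2 * (|f b - f a| + 1) := by positivity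
    have t0 : 0 < t := lt_min (by norm_num) (div_pos (by linarith) hd)
    have t1 : t < 1 := lt_of_le_of_lt (min_le_left _ _) (by norm_num)
    have t2 : t * (2 * (|f b - f a| + 1)) ≤ - f b := by
      rw [← le_div_iff₀ hd]; exact min_le_right _ _
    obtain ⟨x, hx, hx2⟩ := exists_sb hab (t := 1 - t) (by linarith) (by linarith)
    have h1 := h x hx
    rw [hf.line hx2] at h1
    have := mul_le_mul_of_nonneg_left (neg_abs_le (f b - f a)) t0.le
    nlinarith

lemma sg_congr {f g : X → ℝ} (hf : IsAff f) (hg : IsAff g) (h : f = g) : sg f hf = sg g hg := by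
  subst h; rfl

lemma sg_step {f : X → ℝ} (hf : IsAff f) {a b : X} (hab : a ≠ b)
    (h : ∀ x, sb a x b → 0 ≤ f x) :
    (sg f hf (seg a b) = seg a b ∧ sg (-f) hf.neg (seg a b) = 0) ∨
    ((∀ x, sb a x b → f x = 0) ∧ sg f hf (seg a b) = 0 ∧ sg (-f) hf.neg (seg a b) = 0) := by
  obtain ⟨ha, hb⟩ := end_nonneg hf hab h
  have h2 : sg (-f) hf.neg (seg a b) = 0 := sg_nonpos _ (by simpa using ha) (by simpa using hb)
  by_cases hp : 0 < f a ∨ 0 < f b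
  · exact Or.inl ⟨sg_pos hf ha hb hp, h2⟩
  · push Not at hp
    refine Or.inr ⟨fun x hx => ?_, sg_nonpos hf hp.1 hp.2, h2⟩
    exact le_antisymm (bt_nonpos hf hx.1 hp.1 hp.2) (h x hx)

/-- lexicographic half planes -/
def LP (f1 f2 f3 : X → ℝ) : Set X :=
  {x | 0 < f1 x ∨ (f1 x = 0 ∧ (0 < f2 x ∨ (f2 x = 0 ∧ 0 ≤ f3 x)))}

/-- segments supported on a set -/
noncomputable def N1 (K : Set X) : Submodule ℤ (P1 X) :=
  Submodule.span ℤ {z | ∃ a b, z = seg a b ∧ ∀ x, sb a x b → x ∈ K}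

lemma N1_mono : Monotone (N1 (X := X)) := by
  intro K L h
  refine Submodule.span_mono ?_
  rintro _ ⟨a, b, rfl, hx⟩
  exact ⟨a, b, rfl, fun x hx' => h (hx x hx')⟩

lemma N1_cut {f1 f2 f3 : X → ℝ} (h1 : IsAff f1) (h2 : IsAff f2) (h3 : IsAff f3) (K : Set X) :
    N1 K ≤ N1 (K ∩ LP f1 f2 f3) ⊔ N1 (K ∩ LP (-f1) (-f2) (-f3)) := by
  refine Submodule.span_le.2 ?_
  rintro _ ⟨a, b, rfl, hK⟩
  refine split_seg h1 _ a b fun a1 b1 ha1 hb1 s1 => ?_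
  have hK1 : ∀ x, sb a1 x b1 → x ∈ K := fun x hx => hK x (sb_trans ha1 hb1 hx)
  refine split_seg h2 _ a1 b1 fun a2 b2 ha2 hb2 s2 => ?_
  have hK2 : ∀ x, sb a2 x b2 → x ∈ K := fun x hx => hK1 x (sb_trans ha2 hb2 hx)
  have s1' : (0 ≤ f1 a2 ∧ 0 ≤ f1 b2) ∨ (f1 a2 ≤ 0 ∧ f1 b2 ≤ 0) := s1.imp
    (fun h => ⟨bt_nonneg h1 ha2 h.1 h.2, bt_nonneg h1 hb2 h.1 h.2⟩)
    (fun h => ⟨bt_nonpos h1 ha2 h.1 h.2, bt_nonpos h1 hb2 h.1 h.2⟩)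
  refine split_seg h3 _ a2 b2 fun a3 b3 ha3 hb3 s3 => ?_
  have hK3 : ∀ x, sb a3 x b3 → x ∈ K := fun x hx => hK2 x (sb_trans ha3 hb3 hx)
  have s1'' : (0 ≤ f1 a3 ∧ 0 ≤ f1 b3) ∨ (f1 a3 ≤ 0 ∧ f1 b3 ≤ 0) := s1'.imp
    (fun h => ⟨bt_nonneg h1 ha3 h.1 h.2, bt_nonneg h1 hb3 h.1 h.2⟩)
    (fun h => ⟨bt_nonpos h1 ha3 h.1 h.2, bt_nonpos h1 hb3 h.1 h.2⟩)
  have s2'' : (0 ≤ f2 a3 ∧ 0 ≤ f2 b3) ∨ (f2 a3 ≤ 0 ∧ f2 b3 ≤ 0) := s2.imp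
    (fun h => ⟨bt_nonneg h2 ha3 h.1 h.2, bt_nonneg h2 hb3 h.1 h.2⟩)
    (fun h => ⟨bt_nonpos h2 ha3 h.1 h.2, bt_nonpos h2 hb3 h.1 h.2⟩)
  have key : ∀ f : X → ℝ, IsAff f → ((0 ≤ f a3 ∧ 0 ≤ f b3) ∨ (f a3 ≤ 0 ∧ f b3 ≤ 0)) →
      (∀ x, sb a3 x b3 → 0 < f x) ∨ (∀ x, sb a3 x b3 → f x < 0) ∨
      (∀ x, sb a3 x b3 → f x = 0) := by
    intro f hf hs
    rcases hs with hs | hs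
    · by_cases hp : 0 < f a3 ∨ 0 < f b3
      · exact Or.inl fun x hx => sb_pos hf hx hs.1 hs.2 hp
      · push Not at hp
        exact Or.inr (Or.inr fun x hx => le_antisymm (bt_nonpos hf hx.1 hp.1 hp.2)
          (bt_nonneg hf hx.1 hs.1 hs.2))
    · by_cases hp : f a3 < 0 ∨ f b3 < 0
      · refine Or.inr (Or.inl fun x hx => ?_)
        have := sb_pos hf.neg hx (by simpa using hs.1) (by simpa using hs.2) (by simpa using hp)
        simpa using this
      · push Not at hp
        exact Or.inr (Or.inr fun x hx => le_antisymm (bt_nonpos hf hx.1 hs.1 hs.2)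
          (bt_nonneg hf hx.1 hp.1 hp.2))
  have fin : ((∀ x, sb a3 x b3 → x ∈ LP f1 f2 f3) ∨
      ∀ x, sb a3 x b3 → x ∈ LP (-f1) (-f2) (-f3)) := by
    rcases key f1 h1 s1'' with k1 | k1 | k1
    · exact Or.inl fun x hx => Or.inl (k1 x hx)
    · exact Or.inr fun x hx => Or.inl (by simpa using k1 x hx)
    rcases key f2 h2 s2'' with k2 | k2 | k2
    · exact Or.inl fun x hx => Or.inr ⟨k1 x hx, Or.inl (k2 x hx)⟩
    · exact Or.inr fun x hx => Or.inr ⟨by simpa using k1 x hx, Or.inl (by simpa using k2 x hx)⟩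
    rcases key f3 h3 s3 with k3 | k3 | k3
    · exact Or.inl fun x hx => Or.inr ⟨k1 x hx, Or.inr ⟨k2 x hx, (k3 x hx).le⟩⟩
    · exact Or.inr fun x hx => Or.inr ⟨by simpa using k1 x hx, Or.inr
        ⟨by simpa using k2 x hx, by simpa using (k3 x hx).le⟩⟩
    · exact Or.inl fun x hx => Or.inr ⟨k1 x hx, Or.inr ⟨k2 x hx, (k3 x hx).ge⟩⟩
  rcases fin with h | h
  · exact Submodule.mem_sup_left (Submodule.subset_span
      ⟨a3, b3, rfl, fun x hx => ⟨hK3 x hx, h x hx⟩⟩)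
  · exact Submodule.mem_sup_right (Submodule.subset_span
      ⟨a3, b3, rfl, fun x hx => ⟨hK3 x hx, h x hx⟩⟩)

/-- the part of a chain on the zero set -/
noncomputable def zf (f : X → ℝ) (hf : IsAff f) : P1 X →ₗ[ℤ] P1 X :=
  LinearMap.id - sg f hf - sg (-f) hf.neg

/-- the lexicographic half plane operator -/
noncomputable def lpop (f1 f2 f3 : X → ℝ) (h1 : IsAff f1) (h2 : IsAff f2) (h3 : IsAff f3) :
    P1 X →ₗ[ℤ] P1 X :=
  sg f1 h1 + (sg f2 h2 + sg f3 h3 ∘ₗ zf f2 h2) ∘ₗ zf f1 h1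

lemma lp_degenerate {f1 f2 f3 : X → ℝ}
    (hz : ∀ x y, f1 x = 0 → f2 x = 0 → f3 x = 0 → f1 y = 0 → f2 y = 0 → f3 y = 0 → x = y)
    {a b : X} (hab : a ≠ b) (k1 : ∀ x, sb a x b → f1 x = 0) (k2 : ∀ x, sb a x b → f2 x = 0)
    (k3 : ∀ x, sb a x b → f3 x = 0) : False := by
  obtain ⟨x, hx, hx2⟩ := exists_sb hab (t := 1 / 2) (by norm_num) (by norm_num)
  obtain ⟨y, hy, hy2⟩ := exists_sb hab (t := 1 / 3) (by norm_num) (by norm_num)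
  have : x = y := hz x y (k1 x hx) (k2 x hx) (k3 x hx) (k1 y hy) (k2 y hy) (k3 y hy)
  rw [this, hy2] at hx2
  have := AffineMap.lineMap_injective ℝ (fun h => hab (inj h)) hx2
  norm_num at this

lemma N1_disj {f1 f2 f3 : X → ℝ} (h1 : IsAff f1) (h2 : IsAff f2) (h3 : IsAff f3)
    (hz : ∀ x y, f1 x = 0 → f2 x = 0 → f3 x = 0 → f1 y = 0 → f2 y = 0 → f3 y = 0 → x = y)
    (z : P1 X) (hp : z ∈ N1 (LP f1 f2 f3)) (hn : z ∈ N1 (LP (-f1) (-f2) (-f3))) : z = 0 := by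
  have ep : N1 (LP f1 f2 f3) ≤ LinearMap.eqLocus (lpop f1 f2 f3 h1 h2 h3) LinearMap.id := by
    refine Submodule.span_le.2 ?_
    rintro _ ⟨a, b, rfl, hx⟩
    change lpop f1 f2 f3 h1 h2 h3 (seg a b) = seg a b
    by_cases hab : a = b
    · subst hab; simp [seg_self]
    simp only [lpop, zf, LinearMap.add_apply, LinearMap.comp_apply, LinearMap.sub_apply,
      LinearMap.id_apply]
    rcases sg_step h1 hab (fun x hs => by
      rcases hx x hs with h | ⟨h, -⟩
      exacts [h.le, h.ge]) with ⟨e1, e2⟩ | ⟨k1, e1, e2⟩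
    · rw [e1, e2]; simp
    rw [e1, e2]
    simp only [sub_zero, zero_add]
    rcases sg_step h2 hab (fun x hs => by
      rcases hx x hs with h | ⟨-, h | ⟨h, -⟩⟩
      exacts [absurd (k1 x hs) h.ne', h.le, h.ge]) with ⟨e1, e2⟩ | ⟨k2, e1, e2⟩
    · rw [e1, e2]; simp
    rw [e1, e2]
    simp only [sub_zero, zero_add]
    rcases sg_step h3 hab (fun x hs => by
      rcases hx x hs with h | ⟨-, h | ⟨-, h⟩⟩
      exacts [absurd (k1 x hs) h.ne', absurd (k2 x hs) h.ne', h]) with ⟨e1, e2⟩ | ⟨k3, e1, e2⟩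
    · exact e1
    · exact (lp_degenerate hz hab k1 k2 k3).elim
  have en : N1 (LP (-f1) (-f2) (-f3)) ≤ LinearMap.ker (lpop f1 f2 f3 h1 h2 h3) := by
    refine Submodule.span_le.2 ?_
    rintro _ ⟨a, b, rfl, hx⟩
    change lpop f1 f2 f3 h1 h2 h3 (seg a b) = 0
    by_cases hab : a = b
    · subst hab; simp [seg_self]
    simp only [lpop, zf, LinearMap.add_apply, LinearMap.comp_apply, LinearMap.sub_apply,
      LinearMap.id_apply]
    rcases sg_step h1.neg hab (fun x hs => by
      rcases hx x hs with h | ⟨h, -⟩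
      exacts [h.le, h.ge]) with ⟨e1, e2⟩ | ⟨k1, e1, e2⟩
    · rw [sg_congr h1.neg.neg h1 (neg_neg f1)] at e2
      rw [e1, e2]; simp
    rw [sg_congr h1.neg.neg h1 (neg_neg f1)] at e2
    rw [e1, e2]
    simp only [sub_zero, zero_add]
    rcases sg_step h2.neg hab (fun x hs => by
      rcases hx x hs with h | ⟨-, h | ⟨h, -⟩⟩
      exacts [absurd (k1 x hs) h.ne', h.le, h.ge]) with ⟨e1, e2⟩ | ⟨k2, e1, e2⟩
    · rw [sg_congr h2.neg.neg h2 (neg_neg f2)] at e2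
      rw [e1, e2]; simp
    rw [sg_congr h2.neg.neg h2 (neg_neg f2)] at e2
    rw [e1, e2]
    simp only [sub_zero, zero_add]
    rcases sg_step h3.neg hab (fun x hs => by
      rcases hx x hs with h | ⟨-, h | ⟨-, h⟩⟩
      exacts [absurd (k1 x hs) h.ne', absurd (k2 x hs) h.ne', h]) with ⟨e1, e2⟩ | ⟨k3, e1, e2⟩
    · rwa [sg_congr h3.neg.neg h3 (neg_neg f3)] at e2
    · exact (lp_degenerate hz hab (fun x hs => by simpa using k1 x hs)
        (fun x hs => by simpa using k2 x hs) (fun x hs => by simpa using k3 x hs)).elim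
  have e1 : lpop f1 f2 f3 h1 h2 h3 z = z := ep hp
  have e2 : lpop f1 f2 f3 h1 h2 h3 z = 0 := en hn
  rw [← e1, e2]

end lex

section tri
variable {X : Type} [Chart X]
open Chart

/-- the boundary map -/
noncomputable def bd (X : Type) [Chart X] : P1 X →ₗ[ℤ] FreeAbelianGroup X :=
  P1lift (fun a b => FreeAbelianGroup.of b - FreeAbelianGroup.of a)
    (by intros; abel) (by intros; abel)

lemma bd_seg (a b : X) : bd X (seg a b) = FreeAbelianGroup.of b - FreeAbelianGroup.of a :=
  P1lift_seg _ _ _ _ _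

/-- the cone section -/
noncomputable def sec (o : X) : FreeAbelianGroup X →ₗ[ℤ] P1 X :=
  (FreeAbelianGroup.lift (fun x => seg o x)).toIntLinearMap

lemma sec_of (o x : X) : sec o (FreeAbelianGroup.of x) = seg o x :=
  FreeAbelianGroup.lift_apply_of _ _

/-- cycles -/
noncomputable abbrev MM (X : Type) [Chart X] : Submodule ℤ (P1 X) := LinearMap.ker (bd X)

/-- triangles -/
noncomputable def tri (a b c : X) : MM X :=
  ⟨seg a b + seg b c + seg c a, by
    rw [LinearMap.mem_ker, map_add, map_add, bd_seg, bd_seg, bd_seg]; abel⟩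

lemma tri_val (a b c : X) : ((tri a b c : MM X) : P1 X) = seg a b + seg b c + seg c a := rfl

lemma tri_rot (a b c : X) : tri b c a = tri a b c := by
  apply Subtype.ext
  simp only [tri_val]
  abel

lemma tri_split {a p b : X} (h : bt a p b) (c : X) : tri a b c = tri a p c + tri p b c := by
  apply Subtype.ext
  rw [Submodule.coe_add]
  simp only [tri_val]
  rw [← seg_add h, seg_symm p c]
  abel

lemma tri_degenerate {a b c : X} (h : bt a b c ∨ bt b c a ∨ bt c a b) :
    seg a b = seg c b - seg c a := by
  rcases h with h | h | h
  · have := seg_add h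
    rw [seg_symm b c, seg_symm a c, ← this]; abel
  · have := seg_add h
    rw [seg_symm b a, ← this, seg_symm b c]; abel
  · have := seg_add h
    rw [← this]; abel

/-- convex sets -/
def Cv (S : Set X) : Prop := ∀ a b x, a ∈ S → b ∈ S → bt a x b → x ∈ S

/-- cycles supported in a set -/
noncomputable def N2 (K : Set X) : Submodule ℤ (MM X) :=
  Submodule.span ℤ {z | ∃ a b c S, z = tri a b c ∧ Cv S ∧ S ⊆ K ∧ a ∈ S ∧ b ∈ S ∧ c ∈ S}

lemma N2_mono : Monotone (N2 (X := X)) := by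
  intro K L h
  refine Submodule.span_mono ?_
  rintro _ ⟨a, b, c, S, rfl, hS, hSK, ha, hb, hc⟩
  exact ⟨a, b, c, S, rfl, hS, hSK.trans h, ha, hb, hc⟩

lemma tri_cut {f : X → ℝ} (hf : IsAff f) (S : Set X) (hS : Cv S) (Q : Submodule ℤ (MM X))
    (hQ : ∀ a b c, a ∈ S → b ∈ S → c ∈ S → ((0 ≤ f a ∧ 0 ≤ f b ∧ 0 ≤ f c) ∨
      (f a ≤ 0 ∧ f b ≤ 0 ∧ f c ≤ 0)) → tri a b c ∈ Q)
    (a b c : X) (ha : a ∈ S) (hb : b ∈ S) (hc : c ∈ S) : tri a b c ∈ Q := by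
  have same : ∀ {a b : X}, ¬ f a * f b ≤ 0 → (0 < f a ∧ 0 < f b) ∨ (f a < 0 ∧ f b < 0) := by
    intro a b h
    push Not at h
    exact pos_and_pos_or_neg_and_neg_of_mul_pos h
  have hB : ∀ a c p, a ∈ S → c ∈ S → p ∈ S → f p = 0 → tri a c p ∈ Q := by
    intro a c p ha hc hp h0
    by_cases h : f a * f c ≤ 0
    · obtain ⟨q, hq, hq0⟩ := exists_cross hf h
      have hqS := hS _ _ _ ha hc hq
      rw [tri_split hq]
      refine add_mem (hQ _ _ _ ha hqS hp ?_) (hQ _ _ _ hqS hc hp ?_)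
      · rw [hq0, h0]; simpa using le_total _ _
      · rw [hq0, h0]; simpa using le_total _ _
    · refine hQ _ _ _ ha hc hp ?_
      rw [h0]
      rcases same h with h | h
      · exact Or.inl ⟨h.1.le, h.2.le, le_rfl⟩
      · exact Or.inr ⟨h.1.le, h.2.le, le_rfl⟩
  have hC : ∀ a b c, a ∈ S → b ∈ S → c ∈ S → f a * f b ≤ 0 → tri a b c ∈ Q := by
    intro a b c ha hb hc h
    obtain ⟨p, hp, hp0⟩ := exists_cross hf h
    have hpS := hS _ _ _ ha hb hp
    rw [tri_split hp, ← tri_rot p b c, ← tri_rot a p c, ← tri_rot p c a]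
    exact add_mem (hB _ _ _ hc ha hpS hp0) (hB _ _ _ hb hc hpS hp0)
  by_cases h1 : f a * f b ≤ 0
  · exact hC _ _ _ ha hb hc h1
  by_cases h2 : f b * f c ≤ 0
  · rw [← tri_rot]
    exact hC _ _ _ hb hc ha h2
  refine hQ _ _ _ ha hb hc ?_
  rcases same h1 with h1 | h1 <;> rcases same h2 with h2 | h2
  · exact Or.inl ⟨h1.1.le, h1.2.le, h2.2.le⟩
  · linarith [h1.2, h2.1]
  · linarith [h1.2, h2.1]
  · exact Or.inr ⟨h1.1.le, h1.2.le, h2.2.le⟩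

lemma N2_cut {f : X → ℝ} (hf : IsAff f) (K : Set X) :
    N2 K ≤ N2 (K ∩ {x | 0 ≤ f x}) ⊔ N2 (K ∩ {x | f x ≤ 0}) := by
  refine Submodule.span_le.2 ?_
  rintro _ ⟨a, b, c, S, rfl, hS, hSK, ha, hb, hc⟩
  refine tri_cut hf S hS _ ?_ a b c ha hb hc
  intro a b c ha hb hc h
  rcases h with h | h
  · refine Submodule.mem_sup_left (Submodule.subset_span
      ⟨a, b, c, S ∩ {x | 0 ≤ f x}, rfl, ?_, Set.inter_subset_inter_left _ hSK,
        ⟨ha, h.1⟩, ⟨hb, h.2.1⟩, ⟨hc, h.2.2⟩⟩)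
    intro a b x ha hb hx
    exact ⟨hS _ _ _ ha.1 hb.1 hx, bt_nonneg hf hx ha.2 hb.2⟩
  · refine Submodule.mem_sup_right (Submodule.subset_span
      ⟨a, b, c, S ∩ {x | f x ≤ 0}, rfl, ?_, Set.inter_subset_inter_left _ hSK,
        ⟨ha, h.1⟩, ⟨hb, h.2.1⟩, ⟨hc, h.2.2⟩⟩)
    intro a b x ha hb hx
    exact ⟨hS _ _ _ ha.1 hb.1 hx, bt_nonpos hf hx ha.2 hb.2⟩

lemma sg_tri {f : X → ℝ} (hf : IsAff f) (z : MM X) (hz : z ∈ N2 {x | f x ≤ 0}) :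
    sg f hf z = 0 := by
  have : N2 {x | f x ≤ 0} ≤ LinearMap.ker (sg f hf ∘ₗ (MM X).subtype) := by
    refine Submodule.span_le.2 ?_
    rintro _ ⟨a, b, c, S, rfl, hS, hSK, ha, hb, hc⟩
    change sg f hf (tri a b c) = 0
    have ha := hSK ha
    have hb := hSK hb
    have hc := hSK hc
    rw [tri_val, map_add, map_add, sg_nonpos hf ha hb, sg_nonpos hf hb hc, sg_nonpos hf hc ha]
    simp
  exact this hz

lemma zf_mem {f : X → ℝ} (hf : IsAff f) (z : P1 X) :
    zf f hf z ∈ Submodule.span ℤ {z | ∃ a b, z = seg a b ∧ f a = 0 ∧ f b = 0} := by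
  set L := Submodule.span ℤ {z | ∃ a b : X, z = seg a b ∧ f a = 0 ∧ f b = 0}
  have hp : ∀ a b, 0 ≤ f a → 0 ≤ f b → zf f hf (seg a b) ∈ L := by
    intro a b ha hb
    simp only [zf, LinearMap.sub_apply, LinearMap.id_apply]
    rw [sg_nonpos hf.neg (by simpa using ha) (by simpa using hb), sub_zero]
    by_cases h : 0 < f a ∨ 0 < f b
    · rw [sg_pos hf ha hb h]; simp
    · push Not at h
      rw [sg_nonpos hf h.1 h.2, sub_zero]
      exact Submodule.subset_span ⟨a, b, rfl, le_antisymm h.1 ha, le_antisymm h.2 hb⟩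
  have hn : ∀ a b, f a ≤ 0 → f b ≤ 0 → zf f hf (seg a b) ∈ L := by
    intro a b ha hb
    simp only [zf, LinearMap.sub_apply, LinearMap.id_apply]
    rw [sg_nonpos hf ha hb, sub_zero]
    by_cases h : 0 < (-f) a ∨ 0 < (-f) b
    · rw [sg_pos hf.neg (by simpa using ha) (by simpa using hb) h]; simp
    · simp only [Pi.neg_apply] at h
      push Not at h
      rw [sg_nonpos hf.neg h.1 h.2, sub_zero]
      exact Submodule.subset_span ⟨a, b, rfl, by linarith, by linarith⟩
  have : (⊤ : Submodule ℤ (P1 X)) ≤ L.comap (zf f hf) := by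
    rw [← span_seg, Submodule.span_le]
    rintro _ ⟨a, b, rfl⟩
    refine split_seg hf _ a b fun a' b' _ _ h => ?_
    rcases h with h | h
    · exact hp _ _ h.1 h.2
    · exact hn _ _ h.1 h.2
  exact this trivial

lemma N2_disj {f : X → ℝ} (hf : IsAff f)
    (hl : ∀ a b c, f a = 0 → f b = 0 → f c = 0 → bt a b c ∨ bt b c a ∨ bt c a b)
    (z : MM X) (hp : z ∈ N2 {x | 0 ≤ f x}) (hn : z ∈ N2 {x | f x ≤ 0}) : z = 0 := by
  have h1 : sg f hf z = 0 := sg_tri hf z hn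
  have h2 : sg (-f) hf.neg z = 0 := sg_tri hf.neg z (by simpa using hp)
  have h3 : zf f hf z = z := by simp [zf, h1, h2]
  have h4 := zf_mem hf (z : P1 X)
  rw [h3] at h4
  by_cases ho : ∃ o, f o = 0
  · obtain ⟨o, ho⟩ := ho
    have : Submodule.span ℤ {z | ∃ a b : X, z = seg a b ∧ f a = 0 ∧ f b = 0} ≤
        LinearMap.eqLocus LinearMap.id (sec o ∘ₗ bd X) := by
      refine Submodule.span_le.2 ?_
      rintro _ ⟨a, b, rfl, ha, hb⟩
      change seg a b = sec o (bd X (seg a b))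
      rw [bd_seg, map_sub, sec_of, sec_of]
      exact tri_degenerate (hl a b o ha hb ho)
    have h5 : (z : P1 X) = sec o (bd X z) := this h4
    have h6 : bd X z = 0 := z.2
    rw [h6, map_zero] at h5
    exact Subtype.ext h5
  · have : {z | ∃ a b : X, z = seg a b ∧ f a = 0 ∧ f b = 0} = ∅ := by
      ext z
      simp only [Set.mem_ofPred_eq, Set.mem_empty_iff_false, iff_false]
      rintro ⟨a, b, -, h, -⟩
      exact ho ⟨a, h⟩
    rw [this, Submodule.span_empty] at h4
    exact Subtype.ext (by simpa using h4)

/-- the retraction onto cycles -/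
noncomputable def retr (o : X) : P1 X →ₗ[ℤ] MM X :=
  P1lift (fun a b => tri o a b) (by
    intro a b c h
    apply Subtype.ext
    rw [Submodule.coe_add]
    simp only [tri_val]
    rw [← seg_add h, seg_symm o b]; abel) (by
    intro a b
    apply Subtype.ext
    rw [Submodule.coe_add]
    simp only [tri_val]
    rw [seg_symm a b, seg_symm o b, seg_symm o a]
    simp
    abel)

lemma retr_val (o : X) (z : P1 X) : (retr o z : P1 X) = z - sec o (bd X z) := by
  have : (MM X).subtype ∘ₗ retr o = LinearMap.id - sec o ∘ₗ bd X := by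
    apply P1_ext
    intro a b
    change ((retr o (seg a b) : MM X) : P1 X) = seg a b - sec o (bd X (seg a b))
    rw [retr, P1lift_seg, bd_seg, map_sub, sec_of, sec_of, tri_val, seg_symm o b]
    abel
  exact LinearMap.congr_fun this z

lemma retr_self (o : X) (z : MM X) : retr o z = z := by
  apply Subtype.ext
  rw [retr_val]
  have : bd X z = 0 := z.2
  rw [this]; simp

lemma span_tri (o : X) : Submodule.span ℤ {z : MM X | ∃ a b c, z = tri a b c} = ⊤ := by
  rw [eq_top_iff]
  rintro z -
  rw [← retr_self o z]
  have : (⊤ : Submodule ℤ (P1 X)) ≤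
      (Submodule.span ℤ {z : MM X | ∃ a b c, z = tri a b c}).comap (retr o) := by
    rw [← span_seg, Submodule.span_le]
    rintro _ ⟨a, b, rfl⟩
    change retr o (seg a b) ∈ Submodule.span ℤ {z : MM X | ∃ a b c, z = tri a b c}
    rw [retr, P1lift_seg]
    exact Submodule.subset_span ⟨o, a, b, rfl⟩
  exact this trivial

end tri

section action
variable {X : Type} [Chart X] [MulAction G X]
open Chart

/-- the action on segments -/
noncomputable def rho1 (hbt : ∀ (g : G) (a x b : X), bt a x b → bt (g • a) (g • x) (g • b)) :
    Representation ℤ G (P1 X) where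
  toFun g := P1lift (fun a b => seg (g • a) (g • b)) (fun a b c h => seg_add (hbt g _ _ _ h))
    (fun a b => by rw [seg_symm (g • a)]; simp)
  map_one' := by
    apply P1_ext
    intro a b
    rw [P1lift_seg]; simp
  map_mul' g h := by
    apply P1_ext
    intro a b
    rw [P1lift_seg, Module.End.mul_apply, P1lift_seg, P1lift_seg, mul_smul, mul_smul]

variable (hbt : ∀ (g : G) (a x b : X), bt a x b → bt (g • a) (g • x) (g • b))

lemma rho1_seg (g : G) (a b : X) : rho1 hbt g (seg a b) = seg (g • a) (g • b) :=
  P1lift_seg (fun a b => seg (g • a) (g • b)) (fun a b c h => seg_add (hbt g _ _ _ h))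
    (fun a b => by rw [seg_symm (g • a)]; simp) a b

lemma rho1_bd (g : G) (z : P1 X) (hz : z ∈ MM X) : rho1 hbt g z ∈ MM X := by
  have : bd X ∘ₗ rho1 hbt g =
      (FreeAbelianGroup.map (fun x : X => g • x)).toIntLinearMap ∘ₗ bd X := by
    apply P1_ext
    intro a b
    rw [LinearMap.comp_apply, LinearMap.comp_apply, rho1_seg, bd_seg, bd_seg]
    simp
  have h2 := LinearMap.congr_fun this z
  have h3 : bd X z = 0 := hz
  rw [LinearMap.comp_apply, LinearMap.comp_apply, h3, map_zero] at h2
  exact h2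

/-- the action on cycles -/
noncomputable def rho2 : Representation ℤ G (MM X) where
  toFun g := (rho1 hbt g).restrict (rho1_bd hbt g)
  map_one' := by
    apply LinearMap.ext; intro z
    apply Subtype.ext
    change rho1 hbt 1 z = z
    simp
  map_mul' g h := by
    apply LinearMap.ext; intro z
    apply Subtype.ext
    change rho1 hbt (g * h) z = rho1 hbt g (rho1 hbt h z)
    simp

lemma rho2_val (g : G) (z : MM X) : (rho2 hbt g z : P1 X) = rho1 hbt g z := rfl

lemma rho2_tri (g : G) (a b c : X) : rho2 hbt g (tri a b c) = tri (g • a) (g • b) (g • c) := by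
  apply Subtype.ext
  rw [rho2_val, tri_val, tri_val, map_add, map_add, rho1_seg, rho1_seg, rho1_seg]

lemma N1_equiv (g : G) (K : Set X) (z : P1 X) (hz : z ∈ N1 K) :
    rho1 hbt g z ∈ N1 {x | g⁻¹ • x ∈ K} := by
  have : N1 K ≤ (N1 {x | g⁻¹ • x ∈ K}).comap (rho1 hbt g) := by
    refine Submodule.span_le.2 ?_
    rintro _ ⟨a, b, rfl, hK⟩
    change rho1 hbt g (seg a b) ∈ N1 {x | g⁻¹ • x ∈ K}
    rw [rho1_seg]
    refine Submodule.subset_span ⟨_, _, rfl, fun x hx => ?_⟩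
    refine hK _ ⟨?_, ?_, ?_⟩
    · have := hbt g⁻¹ _ _ _ hx.1
      simpa using this
    · rintro rfl
      exact hx.2.1 (by simp)
    · rintro rfl
      exact hx.2.2 (by simp)
  exact this hz

lemma N2_equiv (g : G) (K : Set X) (z : MM X) (hz : z ∈ N2 K) :
    rho2 hbt g z ∈ N2 {x | g⁻¹ • x ∈ K} := by
  have : N2 K ≤ (N2 {x | g⁻¹ • x ∈ K}).comap (rho2 hbt g) := by
    refine Submodule.span_le.2 ?_
    rintro _ ⟨a, b, c, S, rfl, hS, hSK, ha, hb, hc⟩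
    change rho2 hbt g (tri a b c) ∈ N2 {x | g⁻¹ • x ∈ K}
    rw [rho2_tri]
    refine Submodule.subset_span ⟨_, _, _, {x | g⁻¹ • x ∈ S}, rfl, ?_, ?_, ?_, ?_, ?_⟩
    · intro a b x ha hb hx
      exact hS _ _ _ ha hb (hbt g⁻¹ _ _ _ hx)
    · intro x hx
      exact hSK hx
    · simpa using ha
    · simpa using hb
    · simpa using hc
  exact this hz

lemma core_periodic (o : X) (hfin : ∀ x : X, Finite (MulAction.stabilizer G x))
    (hcyc : ∀ x : X, IsCyclic (MulAction.stabilizer G x))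
    (h1 : ∀ n, IsZero (groupCohomology (Rep.of (rho1 hbt).dual) (n + 1)))
    (h2 : ∀ n, IsZero (groupCohomology (Rep.of (rho2 hbt).dual) (n + 1))) (m : ℕ) :
    Nonempty (groupCohomology (Rep.trivial ℤ G ℤ) (m + 3) ≅
      groupCohomology (Rep.trivial ℤ G ℤ) (m + 5)) := by
  let ρ0 := funRep (MulAction.toPermHom G X)
  let f0 : (Representation.trivial ℤ G ℤ).IntertwiningMap ρ0 :=
    { toFun := fun n _ => n
      map_add' := by intros; rfl
      map_smul' := by intros; rfl
      isIntertwining' := by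
        intro g; apply LinearMap.ext; intro n; rfl }
  let F1 : (X → ℤ) → Module.Dual ℤ (P1 X) := fun φ =>
    P1lift (fun a b => φ b - φ a) (by intros; ring) (by intros; ring)
  have F1_seg : ∀ φ a b, F1 φ (seg a b) = φ b - φ a := fun φ a b => P1lift_seg _ _ _ _ _
  let f1 : ρ0.IntertwiningMap (rho1 hbt).dual :=
    { toFun := F1
      map_add' := by
        intro φ ψ
        apply P1_ext; intro a b
        rw [LinearMap.add_apply, F1_seg, F1_seg, F1_seg]
        simp; ring
      map_smul' := by
        intro n φ
        apply P1_ext; intro a b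
        rw [LinearMap.smul_apply, F1_seg, F1_seg]
        simp; ring
      isIntertwining' := by
        intro g; apply LinearMap.ext; intro φ
        apply P1_ext; intro a b
        change F1 (ρ0 g φ) (seg a b) = F1 φ (rho1 hbt g⁻¹ (seg a b))
        rw [rho1_seg, F1_seg, F1_seg]
        rfl }
  let f2 : (rho1 hbt).dual.IntertwiningMap (rho2 hbt).dual :=
    { toFun := fun ν => ν ∘ₗ (MM X).subtype
      map_add' := by intros; rfl
      map_smul' := by intros; rfl
      isIntertwining' := by
        intro g; apply LinearMap.ext; intro ν
        apply LinearMap.ext; intro z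
        rfl }
  have hF1 : ∀ φ z, F1 φ z = (FreeAbelianGroup.lift φ).toIntLinearMap (bd X z) := by
    intro φ z
    have : F1 φ = (FreeAbelianGroup.lift φ).toIntLinearMap ∘ₗ bd X := by
      apply P1_ext
      intro a b
      rw [F1_seg, LinearMap.comp_apply, bd_seg]
      simp
    exact LinearMap.congr_fun this z
  have res : ∀ m, Nonempty (groupCohomology (Rep.trivial ℤ G ℤ) (m + 3) ≅
      groupCohomology (Rep.of ρ0) (m + 3)) := by
    intro m
    refine resolution_shift (Z := Rep.trivial ℤ G ℤ) (A0 := Rep.of ρ0)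
      (A1 := Rep.of (rho1 hbt).dual) (A2 := Rep.of (rho2 hbt).dual)
      (Rep.ofHom f0) (Rep.ofHom f1) (Rep.ofHom f2) ?_ ?_ ?_ ?_ ?_ ?_ h1 h2 m
    · intro a b hab
      exact congrFun hab o
    · apply Rep.hom_ext
      apply Representation.IntertwiningMap.ext
      apply LinearMap.ext
      intro n
      change F1 (fun _ => n) = 0
      apply P1_ext; intro a b
      rw [F1_seg]; simp
    · apply Rep.hom_ext
      apply Representation.IntertwiningMap.ext
      apply LinearMap.ext
      intro φ
      change F1 φ ∘ₗ (MM X).subtype = 0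
      apply LinearMap.ext; intro z
      change F1 φ z = 0
      have : bd X z = 0 := z.2
      rw [hF1, this, map_zero]
    · intro φ hφ
      refine ⟨φ o, ?_⟩
      funext x
      have h3 : F1 φ = 0 := hφ
      have h4 := LinearMap.congr_fun h3 (seg o x)
      rw [F1_seg] at h4
      change φ o = φ x
      have : φ x - φ o = 0 := h4
      linarith
    · intro ν hν
      change Module.Dual ℤ (P1 X) at ν
      have hν : ν ∘ₗ (MM X).subtype = 0 := hν
      refine ⟨fun x => ν (seg o x), ?_⟩
      change F1 (fun x => ν (seg o x)) = ν
      apply P1_ext; intro a b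
      rw [F1_seg]
      have h3 := LinearMap.congr_fun hν (tri o a b)
      change ν (tri o a b : P1 X) = 0 at h3
      rw [tri_val, map_add, map_add, seg_symm o b, map_neg] at h3
      linarith
    · intro μ
      change Module.Dual ℤ (MM X) at μ
      refine ⟨μ ∘ₗ retr o, ?_⟩
      change (μ ∘ₗ retr o) ∘ₗ (MM X).subtype = μ
      apply LinearMap.ext; intro z
      change μ (retr o z) = μ z
      rw [retr_self]
  obtain ⟨i1⟩ := res m
  obtain ⟨i2⟩ := res (m + 2)
  obtain ⟨i3⟩ := funRep_periodic (G := G) (X := X) hfin hcyc (m + 2)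
  exact ⟨i1 ≪≫ i3 ≪≫ i2.symm⟩

end action

/-! ### The hyperbolic plane -/

section hyp

lemma sl2_formulas (A : Matrix.SpecialLinearGroup (Fin 2) ℝ) (z : ℍ) :
    0 < (A 1 0) ^ 2 * (z.re ^ 2 + z.im ^ 2) + 2 * A 1 0 * A 1 1 * z.re + (A 1 1) ^ 2 ∧
    (A • z).re * ((A 1 0) ^ 2 * (z.re ^ 2 + z.im ^ 2) + 2 * A 1 0 * A 1 1 * z.re + (A 1 1) ^ 2) =
      A 0 0 * A 1 0 * (z.re ^ 2 + z.im ^ 2) + (A 0 0 * A 1 1 + A 0 1 * A 1 0) * z.re +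
        A 0 1 * A 1 1 ∧
    (A • z).im * ((A 1 0) ^ 2 * (z.re ^ 2 + z.im ^ 2) + 2 * A 1 0 * A 1 1 * z.re + (A 1 1) ^ 2) =
      z.im ∧
    ((A • z).re ^ 2 + (A • z).im ^ 2) *
      ((A 1 0) ^ 2 * (z.re ^ 2 + z.im ^ 2) + 2 * A 1 0 * A 1 1 * z.re + (A 1 1) ^ 2) =
      (A 0 0) ^ 2 * (z.re ^ 2 + z.im ^ 2) + 2 * A 0 0 * A 0 1 * z.re + (A 0 1) ^ 2 := by
  have hdet : A 0 0 * A 1 1 - A 0 1 * A 1 0 = 1 := by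
    have := A.det_coe
    rwa [Matrix.det_fin_two] at this
  have hw : ((A • z : ℍ) : ℂ) * ((A 1 0 : ℂ) * z + A 1 1) = (A 0 0 : ℂ) * z + A 0 1 := by
    rw [UpperHalfPlane.coe_specialLinearGroup_apply]
    apply div_mul_cancel₀
    intro h
    have h2 := congrArg Complex.im h
    have h3 := congrArg Complex.re h
    simp at h2 h3
    rcases h2 with h2 | h2
    · rw [h2] at h3 hdet
      simp at h3
      rw [h3] at hdet
      simp at hdet
    · exact z.im_pos.ne' h2
  have e1 := congrArg Complex.re hw
  have e2 := congrArg Complex.im hw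
  simp at e1 e2
  set u := (A • z).re
  set v := (A • z).im
  set x := z.re
  set y := z.im
  have hy : 0 < y := z.im_pos
  set a := A 0 0
  set b := A 0 1
  set c := A 1 0
  set d := A 1 1
  refine ⟨?_, ?_, ?_, ?_⟩
  · have : c ^ 2 * (x ^ 2 + y ^ 2) + 2 * c * d * x + d ^ 2 = (c * x + d) ^ 2 + (c * y) ^ 2 := by
      ring
    rw [this]
    by_cases hc : c = 0
    · have hd : d ≠ 0 := by
        rintro h
        rw [hc, h] at hdet
        simp at hdet
      rw [hc]
      have : 0 < d ^ 2 := by positivity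
      nlinarith
    · have : 0 < (c * y) ^ 2 := by positivity
      positivity
  · linear_combination (c * x + d) * e1 + c * y * e2
  · linear_combination (-c * y) * e1 + (c * x + d) * e2 + y * hdet
  · linear_combination ((u * (c * x + d) - v * (c * y)) + (a * x + b)) * e1 +
      ((u * (c * y) + v * (c * x + d)) + a * y) * e2

lemma im_sq_inj {x y : ℝ} (hx : 0 < x) (hy : 0 < y) (h : x ^ 2 = y ^ 2) : x = y := by
  nlinarith [sq_nonneg (x - y)]

lemma uhp_ext {z w : ℍ} (h1 : z.re = w.re) (h2 : z.im = w.im) : z = w :=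
  UpperHalfPlane.ext (Complex.ext h1 h2)

noncomputable instance : Chart ℍ where
  κ z := (z.re, z.re ^ 2 + z.im ^ 2)
  inj := by
    intro z w h
    simp only [Prod.mk.injEq] at h
    refine uhp_ext h.1 (im_sq_inj z.im_pos w.im_pos ?_)
    have := h.2
    rw [h.1] at this
    linarith
  conv := by
    intro a b t h0 h1
    set s := a.re + t * (b.re - a.re) with hs
    set T := (a.re ^ 2 + a.im ^ 2) + t * ((b.re ^ 2 + b.im ^ 2) - (a.re ^ 2 + a.im ^ 2)) with hT
    have hpos : 0 < T - s ^ 2 := by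
      have e : T - s ^ 2 = (1 - t) * a.im ^ 2 + t * b.im ^ 2 +
          t * (1 - t) * (a.re - b.re) ^ 2 := by
        rw [hs, hT]; ring
      rw [e]
      have ha := a.im_pos
      have hb := b.im_pos
      have h3 : 0 ≤ t * (1 - t) * (a.re - b.re) ^ 2 :=
        mul_nonneg (mul_nonneg h0 (by linarith)) (sq_nonneg _)
      rcases h0.eq_or_lt with rfl | h0
      · simp; positivity
      · have h4 : 0 < t * b.im ^ 2 := by positivity
        have h5 : 0 ≤ (1 - t) * a.im ^ 2 := mul_nonneg (by linarith) (sq_nonneg _)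
        linarith
    refine ⟨⟨⟨s, Real.sqrt (T - s ^ 2)⟩, Real.sqrt_pos.2 hpos⟩, ?_⟩
    change (s, s ^ 2 + Real.sqrt (T - s ^ 2) ^ 2) = _
    rw [Real.sq_sqrt hpos.le, AffineMap.lineMap_apply_module']
    ext
    · simp [hs]; ring
    · simp [hT]; ring

lemma kappa_def (z : ℍ) : Chart.κ z = (z.re, z.re ^ 2 + z.im ^ 2) := rfl

lemma isAff_of {f : ℍ → ℝ} (α β γ : ℝ)
    (h : ∀ z : ℍ, f z = α + β * z.re + γ * (z.re ^ 2 + z.im ^ 2)) : IsAff f := by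
  refine ⟨AffineMap.const ℝ (ℝ × ℝ) α +
    (β • LinearMap.fst ℝ ℝ ℝ + γ • LinearMap.snd ℝ ℝ ℝ).toAffineMap, fun z => ?_⟩
  rw [h, kappa_def]
  simp
  ring

lemma isAff_coords {f : ℍ → ℝ} (hf : IsAff f) : ∃ α β γ : ℝ,
    ∀ z : ℍ, f z = α + β * z.re + γ * (z.re ^ 2 + z.im ^ 2) := by
  obtain ⟨F, hF⟩ := hf
  refine ⟨F 0, F.linear (1, 0), F.linear (0, 1), fun z => ?_⟩
  rw [hF, kappa_def]
  have h1 := F.map_vadd 0 (z.re, z.re ^ 2 + z.im ^ 2)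
  simp only [vadd_eq_add, add_zero] at h1
  rw [h1]
  have h2 : ((z.re, z.re ^ 2 + z.im ^ 2) : ℝ × ℝ) = z.re • ((1, 0) : ℝ × ℝ) +
      (z.re ^ 2 + z.im ^ 2) • ((0, 1) : ℝ × ℝ) := by ext <;> simp
  rw [h2, map_add, map_smul, map_smul]
  simp
  ring

lemma mix_real {ux ua ub Jx Ja Jb t : ℝ} (jx : 0 < Jx) (hJ : Jx = (1 - t) * Ja + t * Jb)
    (h : ux * Jx = (1 - t) * (ua * Ja) + t * (ub * Jb)) :
    ux = t * Jb / Jx * (ub - ua) + ua := by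
  have : ux = (ux * Jx) / Jx := by field_simp
  rw [this, h]
  field_simp
  rw [hJ]
  ring

lemma sl2_bt (A : Matrix.SpecialLinearGroup (Fin 2) ℝ) (a x b : ℍ) (h : bt a x b) :
    bt (A • a) (A • x) (A • b) := by
  obtain ⟨t, t0, t1, ht⟩ := bt_param h
  obtain ⟨ja, ra, -, qa⟩ := sl2_formulas A a
  obtain ⟨jb, rb, -, qb⟩ := sl2_formulas A b
  obtain ⟨jx, rx, -, qx⟩ := sl2_formulas A x
  rw [kappa_def, kappa_def, kappa_def, AffineMap.lineMap_apply_module'] at ht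
  have h1 : x.re = t * (b.re - a.re) + a.re := congrArg Prod.fst ht
  have h2 : x.re ^ 2 + x.im ^ 2 = t * ((b.re ^ 2 + b.im ^ 2) - (a.re ^ 2 + a.im ^ 2)) +
    (a.re ^ 2 + a.im ^ 2) := congrArg Prod.snd ht
  have k1 := kappa_def (A • a)
  have k2 := kappa_def (A • b)
  have k3 := kappa_def (A • x)
  generalize (A • a).re ^ 2 + (A • a).im ^ 2 = Qa at *
  generalize (A • b).re ^ 2 + (A • b).im ^ 2 = Qb at *
  generalize (A • x).re ^ 2 + (A • x).im ^ 2 = Qx at *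
  generalize (A • a).re = Ra at *
  generalize (A • b).re = Rb at *
  generalize (A • x).re = Rx at *
  generalize a.re ^ 2 + a.im ^ 2 = qqa at *
  generalize b.re ^ 2 + b.im ^ 2 = qqb at *
  generalize x.re ^ 2 + x.im ^ 2 = qqx at *
  generalize a.re = rra at *
  generalize b.re = rrb at *
  generalize x.re = rrx at *
  generalize A 1 0 = c at *
  generalize A 1 1 = d at *
  generalize A 0 0 = e at *
  generalize A 0 1 = f at *
  have hJ : c ^ 2 * qqx + 2 * c * d * rrx + d ^ 2 =
      (1 - t) * (c ^ 2 * qqa + 2 * c * d * rra + d ^ 2) +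
        t * (c ^ 2 * qqb + 2 * c * d * rrb + d ^ 2) := by
    rw [h2, h1]; ring
  refine bt_of_param (t := t * (c ^ 2 * qqb + 2 * c * d * rrb + d ^ 2) /
    (c ^ 2 * qqx + 2 * c * d * rrx + d ^ 2))
    (div_nonneg (mul_nonneg t0 jb.le) jx.le) ?_ ?_
  · rw [div_le_one jx, hJ]
    nlinarith [mul_nonneg (sub_nonneg.2 t1) ja.le]
  · rw [k1, k2, k3, AffineMap.lineMap_apply_module']
    refine Prod.ext ?_ ?_
    · refine mix_real jx hJ ?_
      rw [rx, ra, rb, h2, h1]; ring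
    · refine mix_real jx hJ ?_
      rw [qx, qa, qb, h2, h1]; ring

/-- the functions used as keys -/
noncomputable def keyf (α β γ : ℝ) (z : ℍ) : ℝ :=
  (α + β * z.re + γ * (z.re ^ 2 + z.im ^ 2)) / z.im

lemma keyf_aff (α β γ : ℝ) (A B : Matrix.SpecialLinearGroup (Fin 2) ℝ) :
    IsAff (fun z : ℍ => (keyf α β γ (A • z) - keyf α β γ (B • z)) * z.im) := by
  have h : ∀ A : Matrix.SpecialLinearGroup (Fin 2) ℝ, ∃ α' β' γ' : ℝ, ∀ z : ℍ,
      keyf α β γ (A • z) * z.im = α' + β' * z.re + γ' * (z.re ^ 2 + z.im ^ 2) := by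
    intro A
    refine ⟨α * (A 1 1) ^ 2 + β * (A 0 1 * A 1 1) + γ * (A 0 1) ^ 2,
      α * (2 * A 1 0 * A 1 1) + β * (A 0 0 * A 1 1 + A 0 1 * A 1 0) + γ * (2 * A 0 0 * A 0 1),
      α * (A 1 0) ^ 2 + β * (A 0 0 * A 1 0) + γ * (A 0 0) ^ 2, fun z => ?_⟩
    obtain ⟨hj, hr, hi, hq⟩ := sl2_formulas A z
    set J := (A 1 0) ^ 2 * (z.re ^ 2 + z.im ^ 2) + 2 * A 1 0 * A 1 1 * z.re + (A 1 1) ^ 2 with hJ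
    have hp := (A • z).im_pos
    have : keyf α β γ (A • z) * z.im = α * J + β * ((A • z).re * J) +
        γ * (((A • z).re ^ 2 + (A • z).im ^ 2) * J) := by
      rw [keyf, ← hi]
      field_simp
    rw [this, hr, hq, hJ]
    ring
  obtain ⟨a1, b1, c1, h1⟩ := h A
  obtain ⟨a2, b2, c2, h2⟩ := h B
  refine isAff_of (a1 - a2) (b1 - b2) (c1 - c2) fun z => ?_
  rw [sub_mul, h1, h2]; ring

lemma aff_collinear {f : ℍ → ℝ} (hf : IsAff f) (p : ℍ) (hp : f p ≠ 0) (a b c : ℍ)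
    (ha : f a = 0) (hb : f b = 0) (hc : f c = 0) : bt a b c ∨ bt b c a ∨ bt c a b := by
  obtain ⟨α, β, γ, h⟩ := isAff_coords hf
  apply Collinear.wbtw_or_wbtw_or_wbtw
  rw [collinear_iff_of_mem (p₀ := Chart.κ a) (by simp)]
  have hne : 0 < β ^ 2 + γ ^ 2 := by
    by_contra hcon
    have h1 : β = 0 := by nlinarith [sq_nonneg β, sq_nonneg γ]
    have h2 : γ = 0 := by nlinarith [sq_nonneg β, sq_nonneg γ]
    rw [h, h1, h2] at hp ha
    simp at hp ha
    exact hp ha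
  refine ⟨(-γ, β), ?_⟩
  have key : ∀ x : ℍ, f x = 0 → ∃ r : ℝ, Chart.κ x = r • ((-γ, β) : ℝ × ℝ) +ᵥ Chart.κ a := by
    intro x hx
    refine ⟨(β * ((x.re ^ 2 + x.im ^ 2) - (a.re ^ 2 + a.im ^ 2)) - γ * (x.re - a.re)) /
      (β ^ 2 + γ ^ 2), ?_⟩
    rw [h] at hx ha
    rw [kappa_def, kappa_def]
    ext
    · simp
      field_simp
      linear_combination β * (hx - ha)
    · simp
      field_simp
      linear_combination γ * (hx - ha)
  intro q hq
  rcases hq with rfl | rfl | rfl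
  · exact key a ha
  · exact key b hb
  · exact key c hc

lemma keyf_dist (p z : ℍ) : keyf (p.re ^ 2 + p.im ^ 2) (-2 * p.re) 1 z =
    2 * p.im * Real.cosh (dist z p) := by
  rw [UpperHalfPlane.cosh_dist, keyf, Complex.dist_eq, Complex.sq_norm, Complex.normSq_apply]
  have := z.im_pos
  have := p.im_pos
  simp
  field_simp
  ring

lemma keyf_lt (p z w : ℍ) : keyf (p.re ^ 2 + p.im ^ 2) (-2 * p.re) 1 z <
    keyf (p.re ^ 2 + p.im ^ 2) (-2 * p.re) 1 w ↔ dist z p < dist w p := by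
  rw [keyf_dist, keyf_dist, mul_lt_mul_iff_right₀ (by have := p.im_pos; positivity),
    Real.cosh_lt_cosh, abs_of_nonneg dist_nonneg, abs_of_nonneg dist_nonneg]

end hyp

/-! ### Groups acting on the hyperbolic plane -/

section act

/-- disc coordinate -/
noncomputable def disc (τ z : ℍ) : ℂ := ((z : ℂ) - τ) / ((z : ℂ) - (starRingEnd ℂ) τ)

lemma sub_conj_ne (τ z : ℍ) : (z : ℂ) - (starRingEnd ℂ) (τ : ℂ) ≠ 0 := by
  intro h
  have := congrArg Complex.im h
  simp at this
  have h1 := z.im_pos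
  have h2 := τ.im_pos
  linarith

lemma disc_inj (τ z w : ℍ) (h : disc τ z = disc τ w) : z = w := by
  unfold disc at h
  rw [div_eq_div_iff (sub_conj_ne τ z) (sub_conj_ne τ w)] at h
  have h2 : ((z : ℂ) - w) * ((τ : ℂ) - (starRingEnd ℂ) (τ : ℂ)) = 0 := by
    linear_combination h
  rcases mul_eq_zero.1 h2 with h3 | h3
  · exact UpperHalfPlane.ext (sub_eq_zero.1 h3)
  · exact absurd h3 (sub_conj_ne τ τ)

lemma disc_ne (τ z : ℍ) (h : z ≠ τ) : disc τ z ≠ 0 := by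
  unfold disc
  refine div_ne_zero ?_ (sub_conj_ne τ z)
  intro h2
  exact h (UpperHalfPlane.ext (sub_eq_zero.1 h2))

lemma sl2_disc (A : Matrix.SpecialLinearGroup (Fin 2) ℝ) (τ : ℍ) (h : A • τ = τ) :
    ∃ χ : ℂ, ∀ z : ℍ, disc τ (A • z) = χ * disc τ z := by
  have hdet : (A 0 0 : ℂ) * A 1 1 - A 0 1 * A 1 0 = 1 := by
    have := A.det_coe
    rw [Matrix.det_fin_two] at this
    exact_mod_cast this
  have hD : ∀ z : ℍ, (A 1 0 : ℂ) * z + A 1 1 ≠ 0 := by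
    intro z hz
    have h2 := congrArg Complex.im hz
    have h3 := congrArg Complex.re hz
    have hdet' : A 0 0 * A 1 1 - A 0 1 * A 1 0 = 1 := by exact_mod_cast hdet
    simp at h2 h3
    rcases h2 with h2 | h2
    · rw [h2] at h3 hdet'
      simp at h3
      rw [h3] at hdet'
      simp at hdet'
    · exact z.im_pos.ne' h2
  have hw : ∀ z : ℍ, ((A • z : ℍ) : ℂ) * ((A 1 0 : ℂ) * z + A 1 1) = (A 0 0 : ℂ) * z + A 0 1 := by
    intro z
    rw [UpperHalfPlane.coe_specialLinearGroup_apply]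
    exact div_mul_cancel₀ _ (hD z)
  have hτ := hw τ
  rw [h] at hτ
  have hτ' := congrArg (starRingEnd ℂ) hτ
  have hDτ' : (A 1 0 : ℂ) * (starRingEnd ℂ) (τ : ℂ) + A 1 1 ≠ 0 := by
    intro h0
    have := congrArg (starRingEnd ℂ) h0
    simp at this
    exact hD τ this
  simp only [map_mul, map_add, Complex.conj_ofReal] at hτ'
  refine ⟨((A 1 0 : ℂ) * (starRingEnd ℂ) (τ : ℂ) + A 1 1) / ((A 1 0 : ℂ) * τ + A 1 1), ?_⟩
  intro z
  have hz := hw z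
  have n1 := sub_conj_ne τ z
  have n2 := sub_conj_ne τ (A • z)
  have n3 := hD τ
  have n4 := hD z
  unfold disc
  generalize ((A • z : ℍ) : ℂ) = w at *
  generalize (starRingEnd ℂ) (τ : ℂ) = t' at *
  generalize (τ : ℂ) = t at *
  generalize (z : ℂ) = z at *
  generalize (A 0 0 : ℂ) = a at *
  generalize (A 0 1 : ℂ) = b at *
  generalize (A 1 0 : ℂ) = c at *
  generalize (A 1 1 : ℂ) = d at *
  have e1 : w - t = (z - t) / ((c * z + d) * (c * t + d)) := by
    rw [eq_div_iff (mul_ne_zero n4 n3)]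
    linear_combination (c * t + d) * hz - (c * z + d) * hτ + (z - t) * hdet
  have e2 : w - t' = (z - t') / ((c * z + d) * (c * t' + d)) := by
    rw [eq_div_iff (mul_ne_zero n4 hDτ')]
    linear_combination (c * t' + d) * hz - (c * z + d) * hτ' + (z - t') * hdet
  rw [e1, e2]
  clear e1 e2 hz hτ hτ' hw hD
  generalize c * z + d = Dz at *
  generalize c * t + d = Dt at *
  generalize c * t' + d = Dt' at *
  generalize z - t = u at *
  generalize z - t' = v at *
  field_simp

variable {G : Type} [Group G] [MulAction G ℍ]

lemma act_chi (hmat : ∀ g : G, ∃ A : Matrix.SpecialLinearGroup (Fin 2) ℝ, ∀ z : ℍ, g • z = A • z)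
    (τ : ℍ) (g : G) (hg : g • τ = τ) : ∃ χ : ℂ, ∀ z : ℍ, disc τ (g • z) = χ * disc τ z := by
  obtain ⟨A, hA⟩ := hmat g
  obtain ⟨χ, h⟩ := sl2_disc A τ (by rw [← hA, hg])
  exact ⟨χ, fun z => by rw [hA, h]⟩

lemma fix_unique
    (hmat : ∀ g : G, ∃ A : Matrix.SpecialLinearGroup (Fin 2) ℝ, ∀ z : ℍ, g • z = A • z)
    (hfaith : ∀ g : G, (∀ z : ℍ, g • z = z) → g = 1) (g : G) (hg : g ≠ 1) (x y : ℍ)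
    (hx : g • x = x) (hy : g • y = y) : x = y := by
  by_contra hne
  obtain ⟨χ, h⟩ := act_chi hmat x g hx
  have h1 := h y
  rw [hy] at h1
  have h2 : χ = 1 := by
    have := disc_ne x y (Ne.symm hne)
    field_simp at h1
    exact h1.symm
  refine hg (hfaith g fun z => disc_inj x _ _ ?_)
  rw [h, h2, one_mul]

lemma stab_cyclic
    (hmat : ∀ g : G, ∃ A : Matrix.SpecialLinearGroup (Fin 2) ℝ, ∀ z : ℍ, g • z = A • z)
    (hfaith : ∀ g : G, (∀ z : ℍ, g • z = z) → g = 1) (τ : ℍ)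
    (hfin : Finite (MulAction.stabilizer G τ)) : IsCyclic (MulAction.stabilizer G τ) := by
  choose χ hχ using fun g : MulAction.stabilizer G τ => act_chi hmat τ g g.2
  obtain ⟨z0, hz0⟩ : ∃ z0 : ℍ, z0 ≠ τ := by
    refine ⟨⟨⟨τ.re + 1, τ.im⟩, τ.im_pos⟩, fun h => ?_⟩
    have := congrArg UpperHalfPlane.re h
    change τ.re + 1 = τ.re at this
    linarith
  have hd := disc_ne τ z0 hz0
  let f : MulAction.stabilizer G τ →* ℂ :=
    { toFun := χ
      map_one' := by
        have h := hχ 1 z0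
        rw [OneMemClass.coe_one, one_smul] at h
        exact mul_right_cancel₀ hd (h.symm.trans (one_mul _).symm)
      map_mul' := by
        intro g h
        have h1 := hχ (g * h) z0
        have h2 := hχ g ((h : G) • z0)
        rw [hχ h z0] at h2
        rw [Subgroup.coe_mul, mul_smul, h2] at h1
        apply mul_right_cancel₀ hd
        rw [← h1]; ring }
  refine isCyclic_of_injective_ringHom f ?_
  intro g h hgh
  have hgh' : χ g = χ h := hgh
  have : (h : G)⁻¹ * g = 1 := by
    apply hfaith
    intro z
    rw [mul_smul, inv_smul_eq_iff]
    apply disc_inj τ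
    rw [hχ, hχ, hgh']
  apply Subtype.ext
  exact (inv_mul_eq_one.1 this).symm

lemma exists_free
    (hmat : ∀ g : G, ∃ A : Matrix.SpecialLinearGroup (Fin 2) ℝ, ∀ z : ℍ, g • z = A • z)
    (hfaith : ∀ g : G, (∀ z : ℍ, g • z = z) → g = 1)
    (hprop : ∀ (p q : ℍ) (R : ℝ), {g : G | dist (g • p) q ≤ R}.Finite) :
    ∃ p : ℍ, ∀ g : G, g • p = p → g = 1 := by
  have hG : Countable G := by
    rw [← Set.countable_univ_iff]
    have : (Set.univ : Set G) ⊆ ⋃ n : ℕ, {g : G | dist (g • UpperHalfPlane.I) UpperHalfPlane.I ≤ n} := by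
      intro g _
      obtain ⟨n, hn⟩ := exists_nat_ge (dist (g • UpperHalfPlane.I) UpperHalfPlane.I)
      exact Set.mem_iUnion.2 ⟨n, hn⟩
    exact (Set.countable_iUnion fun n => (hprop _ _ _).countable).mono this
  by_contra hcon
  push Not at hcon
  have hc : (Set.univ : Set ℍ).Countable := by
    have : (Set.univ : Set ℍ) ⊆ ⋃ g : {g : G // g ≠ 1}, {z : ℍ | (g : G) • z = z} := by
      intro p _
      obtain ⟨g, h1, h2⟩ := hcon p
      exact Set.mem_iUnion.2 ⟨⟨g, h2⟩, h1⟩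
    refine (Set.countable_iUnion fun g => ?_).mono this
    apply Set.Subsingleton.countable
    intro x hx y hy
    exact fix_unique hmat hfaith g g.2 x y hx hy
  have hcc : Countable ℍ := Set.countable_univ_iff.1 hc
  have : Countable ℝ := by
    refine Function.Injective.countable (f := fun r : ℝ => (⟨⟨r, 1⟩, one_pos⟩ : ℍ)) ?_
    intro a b h
    exact congrArg UpperHalfPlane.re h
  exact not_countable (α := ℝ)  this

/-- difference of keys -/
noncomputable def fk (α β γ : ℝ) (i j : G) (x : ℍ) : ℝ :=
  (keyf α β γ (j⁻¹ • x) - keyf α β γ (i⁻¹ • x)) * x.im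

lemma fk_aff
    (hmat : ∀ g : G, ∃ A : Matrix.SpecialLinearGroup (Fin 2) ℝ, ∀ z : ℍ, g • z = A • z)
    (α β γ : ℝ) (i j : G) : IsAff (fk α β γ i j) := by
  obtain ⟨A, hA⟩ := hmat j⁻¹
  obtain ⟨B, hB⟩ := hmat i⁻¹
  have := keyf_aff α β γ A B
  simp only [← hA, ← hB] at this
  exact this

lemma fk_neg (α β γ : ℝ) (i j : G) : fk α β γ j i = - fk α β γ i j := by
  funext x
  simp only [fk, Pi.neg_apply]
  ring

lemma fk_pos (α β γ : ℝ) (i j : G) (x : ℍ) :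
    0 < fk α β γ i j x ↔ keyf α β γ (i⁻¹ • x) < keyf α β γ (j⁻¹ • x) := by
  rw [fk, mul_pos_iff_of_pos_right x.im_pos, sub_pos]

lemma fk_zero (α β γ : ℝ) (i j : G) (x : ℍ) :
    fk α β γ i j x = 0 ↔ keyf α β γ (i⁻¹ • x) = keyf α β γ (j⁻¹ • x) := by
  rw [fk, mul_eq_zero, sub_eq_zero, or_iff_left x.im_pos.ne', eq_comm]

lemma fk_nonneg (α β γ : ℝ) (i j : G) (x : ℍ) :
    0 ≤ fk α β γ i j x ↔ keyf α β γ (i⁻¹ • x) ≤ keyf α β γ (j⁻¹ • x) := by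
  rw [fk, mul_nonneg_iff_of_pos_right x.im_pos, sub_nonneg]

lemma J_finite (hprop : ∀ (p q : ℍ) (R : ℝ), {g : G | dist (g • p) q ≤ R}.Finite) (p a : ℍ) :
    {g : G | dist (g⁻¹ • a) p ≤ dist a p}.Finite :=
  (hprop a p (dist a p)).preimage (inv_injective.injOn)

lemma J_pos (p a : ℍ) (j : G) (h : ¬ dist (j⁻¹ • a) p ≤ dist a p) :
    0 < fk (p.re ^ 2 + p.im ^ 2) (-2 * p.re) 1 (1 : G) j a := by
  rw [fk_pos, keyf_lt]
  simpa using h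

lemma acyclic2
    (hmat : ∀ g : G, ∃ A : Matrix.SpecialLinearGroup (Fin 2) ℝ, ∀ z : ℍ, g • z = A • z)
    (hfaith : ∀ g : G, (∀ z : ℍ, g • z = z) → g = 1)
    (hprop : ∀ (p q : ℍ) (R : ℝ), {g : G | dist (g • p) q ≤ R}.Finite)
    (hbt : ∀ (g : G) (a x b : ℍ), bt a x b → bt (g • a) (g • x) (g • b)) (n : ℕ) :
    IsZero (groupCohomology (Rep.of (rho2 hbt).dual) (n + 1)) := by
  obtain ⟨p, hp⟩ := exists_free hmat hfaith hprop
  set α := p.re ^ 2 + p.im ^ 2 with hα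
  set β := -2 * p.re with hβ
  have hH : ∀ i j : G, {x : ℍ | fk α β 1 j i x ≤ 0} = {x | 0 ≤ fk α β 1 i j x} := by
    intro i j
    rw [fk_neg α β 1 i j]
    ext x; simp
  have hH' : ∀ i j : G, {x : ℍ | fk α β 1 i j x ≤ 0} = {x | 0 ≤ fk α β 1 j i x} :=
    fun i j => hH j i
  refine acyclic_of_cells (rho2 hbt) N2 N2_mono (fun i j => {x : ℍ | 0 ≤ fk α β 1 i j x})
    ?_ ?_ ?_ ?_ (N2_equiv hbt) ?_ _ (span_tri p) ?_ n
  · intro i x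
    simp [fk]
  · intro i j k x h1 h2
    simp only [Set.mem_ofPred_eq, fk_nonneg] at *
    exact h1.trans h2
  · intro K i j hij
    have := N2_cut (fk_aff hmat α β 1 i j) K
    rwa [hH'] at this
  · intro i j hij z h1 h2
    refine N2_disj (fk_aff hmat α β 1 i j) ?_ z h1 (by rw [hH']; exact h2)
    refine aff_collinear (fk_aff hmat α β 1 i j) (i • p) ?_
    apply ne_of_gt
    rw [fk_pos, keyf_lt, inv_smul_smul, dist_self, dist_pos]
    intro h
    rw [← mul_smul] at h
    have := hp _ h
    exact hij (inv_mul_eq_one.1 this).symm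
  · intro g i j x h
    simp only [Set.mem_ofPred_eq, fk_nonneg] at *
    simpa [mul_smul] using h
  · rintro s ⟨a, b, c, rfl⟩
    set J : Set G := {g : G | dist (g⁻¹ • a) p ≤ dist a p} ∪ {g : G | dist (g⁻¹ • b) p ≤ dist b p} ∪
      {g : G | dist (g⁻¹ • c) p ≤ dist c p} with hJ
    refine ⟨{x | ∀ j ∉ J, 0 < fk α β 1 (1 : G) j x}, J, 1,
      ((J_finite hprop p a).union (J_finite hprop p b)).union (J_finite hprop p c), ?_, ?_, ?_⟩
    · simp [hJ]
    · refine Submodule.subset_span ⟨a, b, c, _, rfl, ?_, subset_rfl, ?_, ?_, ?_⟩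
      · intro u v x hu hv hx j hj
        exact bt_pos (fk_aff hmat α β 1 1 j) hx (hu j hj) (hv j hj)
      · intro j hj
        exact J_pos p a j fun h => hj (Or.inl (Or.inl h))
      · intro j hj
        exact J_pos p b j fun h => hj (Or.inl (Or.inr h))
      · intro j hj
        exact J_pos p c j fun h => hj (Or.inr h)
    · intro j hj x hx
      exact (hx j hj).le

lemma acyclic1
    (hmat : ∀ g : G, ∃ A : Matrix.SpecialLinearGroup (Fin 2) ℝ, ∀ z : ℍ, g • z = A • z)
    (hfaith : ∀ g : G, (∀ z : ℍ, g • z = z) → g = 1)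
    (hprop : ∀ (p q : ℍ) (R : ℝ), {g : G | dist (g • p) q ≤ R}.Finite)
    (hbt : ∀ (g : G) (a x b : ℍ), bt a x b → bt (g • a) (g • x) (g • b)) (n : ℕ) :
    IsZero (groupCohomology (Rep.of (rho1 hbt).dual) (n + 1)) := by
  obtain ⟨p, hp⟩ : ∃ p : ℍ, p = UpperHalfPlane.I := ⟨_, rfl⟩
  set α := p.re ^ 2 + p.im ^ 2 with hα
  set β := -2 * p.re with hβ
  have hH : ∀ i j : G, LP (-fk α β 1 i j) (-fk 0 1 0 i j) (-fk 1 0 0 i j) =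
      LP (fk α β 1 j i) (fk 0 1 0 j i) (fk 1 0 0 j i) := by
    intro i j
    rw [fk_neg α β 1 i j, fk_neg 0 1 0 i j, fk_neg 1 0 0 i j]
  refine acyclic_of_cells (rho1 hbt) N1 N1_mono
    (fun i j => LP (fk α β 1 i j) (fk 0 1 0 i j) (fk 1 0 0 i j))
    ?_ ?_ ?_ ?_ (N1_equiv hbt) ?_ _ span_seg ?_ n
  · intro i x
    simp [LP, fk]
  · intro i j k x h1 h2
    simp only [LP, Set.mem_ofPred_eq, fk_nonneg, fk_pos, fk_zero] at *
    grind
  · intro K i j hij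
    have := N1_cut (fk_aff hmat α β 1 i j) (fk_aff hmat 0 1 0 i j) (fk_aff hmat 1 0 0 i j) K
    rwa [hH] at this
  · intro i j hij z h1 h2
    refine N1_disj (fk_aff hmat α β 1 i j) (fk_aff hmat 0 1 0 i j) (fk_aff hmat 1 0 0 i j) ?_ z h1
      (by rw [hH]; exact h2)
    have key : ∀ x, fk 0 1 0 i j x = 0 → fk 1 0 0 i j x = 0 → (j * i⁻¹) • x = x := by
      intro x e1 e2
      rw [fk_zero] at e1 e2
      simp only [keyf, zero_add, one_mul, zero_mul, add_zero] at e1 e2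
      have q1 := (i⁻¹ • x).im_pos
      have q2 := (j⁻¹ • x).im_pos
      have e3 : (i⁻¹ • x).im = (j⁻¹ • x).im := by
        field_simp at e2
        exact e2.symm
      rw [e3] at e1
      have e4 : (i⁻¹ • x).re = (j⁻¹ • x).re := by
        field_simp at e1
        exact e1
      have e5 := uhp_ext e4 e3
      rw [mul_smul, e5, smul_inv_smul]
    have hne : j * i⁻¹ ≠ 1 := fun h => hij (mul_inv_eq_one.1 h).symm
    intros
    apply fix_unique hmat hfaith _ hne <;> apply key <;> tauto
  · intro g i j x h
    simp only [LP, Set.mem_ofPred_eq, fk_nonneg, fk_pos, fk_zero] at *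
    simpa [mul_smul] using h
  · rintro s ⟨a, b, rfl⟩
    set J : Set G := {g : G | dist (g⁻¹ • a) p ≤ dist a p} ∪ {g : G | dist (g⁻¹ • b) p ≤ dist b p}
      with hJ
    refine ⟨{x | bt a x b}, J, 1,
      (J_finite hprop p a).union (J_finite hprop p b), ?_, ?_, ?_⟩
    · simp [hJ]
    · exact Submodule.subset_span ⟨a, b, rfl, fun x hx => hx.1⟩
    · intro j hj x hx
      left
      exact bt_pos (fk_aff hmat α β 1 1 j) hx (J_pos p a j fun h => hj (Or.inl h))
        (J_pos p b j fun h => hj (Or.inr h))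

theorem act_periodic
    (hmat : ∀ g : G, ∃ A : Matrix.SpecialLinearGroup (Fin 2) ℝ, ∀ z : ℍ, g • z = A • z)
    (hfaith : ∀ g : G, (∀ z : ℍ, g • z = z) → g = 1)
    (hprop : ∀ (p q : ℍ) (R : ℝ), {g : G | dist (g • p) q ≤ R}.Finite) (m : ℕ) :
    Nonempty (groupCohomology (Rep.trivial ℤ G ℤ) (m + 3) ≅
      groupCohomology (Rep.trivial ℤ G ℤ) (m + 5)) := by
  have hbt : ∀ (g : G) (a x b : ℍ), bt a x b → bt (g • a) (g • x) (g • b) := by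
    intro g a x b h
    obtain ⟨A, hA⟩ := hmat g
    rw [hA, hA, hA]
    exact sl2_bt A a x b h
  have hfin : ∀ x : ℍ, Finite (MulAction.stabilizer G x) := by
    intro x
    refine ((hprop x x 0).subset ?_).to_subtype
    intro g hg
    have : g • x = x := hg
    simp [this]
  exact core_periodic hbt UpperHalfPlane.I hfin
    (fun x => stab_cyclic hmat hfaith x (hfin x))
    (acyclic1 hmat hfaith hprop hbt) (acyclic2 hmat hfaith hprop hbt) m

end act

/-! ### The group PSL(2,R) -/

section psl

lemma sl2_top_eq : (instTopologicalSpaceSL2R : TopologicalSpace SL2R) =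
    Matrix.SpecialLinearGroup.instTopologicalSpace := rfl

instance sl2_topgroup : IsTopologicalGroup SL2R :=
  Matrix.SpecialLinearGroup.topologicalGroup (n := Fin 2) (R := ℝ)

instance sl2_t2 : T2Space SL2R :=
  (Matrix.SpecialLinearGroup.isClosedEmbedding_val (n := Fin 2) (R := ℝ)).isEmbedding.t2Space

lemma sl2_compact (p q : ℍ) (R : ℝ) : IsCompact {A : SL2R | dist (A • p) q ≤ R} := by
  have hp : @IsProperMap (SL2R × ℍ) (ℍ × ℍ) (@instTopologicalSpaceProd SL2R ℍ
      Matrix.SpecialLinearGroup.instTopologicalSpace _) _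
      (fun x => (x.1 • x.2, x.2)) := ProperSMul.isProperMap_smul_pair
  have h1 : IsCompact ((Metric.closedBall q R) ×ˢ ({p} : Set ℍ)) :=
    (isCompact_closedBall q R).prod isCompact_singleton
  have h2 := hp.isCompact_preimage h1
  have h3 := h2.image (continuous_fst)
  refine Eq.mp ?_ h3
  congr 1
  ext A
  constructor
  · rintro ⟨⟨B, z⟩, hB, rfl⟩
    simp at hB
    obtain ⟨h4, rfl⟩ := hB
    exact h4
  · intro h
    exact ⟨(A, p), by simpa using h, rfl⟩

lemma center_smul (A : SL2R) (hA : A ∈ Subgroup.center SL2R) (z : ℍ) : A • z = z := by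
  rw [Matrix.SpecialLinearGroup.mem_center_iff] at hA
  obtain ⟨r, hr, h⟩ := hA
  have hr0 : r ≠ 0 := by
    rintro rfl
    simp at hr
  apply UpperHalfPlane.ext
  rw [UpperHalfPlane.coe_specialLinearGroup_apply, ← h]
  have : (r : ℂ) ≠ 0 := by exact_mod_cast hr0
  simp
  field_simp

lemma smul_center (A : SL2R) (hA : ∀ z : ℍ, A • z = z) : A ∈ Subgroup.center SL2R := by
  have hdet : A 0 0 * A 1 1 - A 0 1 * A 1 0 = 1 := by
    have := A.det_coe
    rwa [Matrix.det_fin_two] at this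
  have key : ∀ y : ℝ, 0 < y → A 1 0 ^ 2 * y ^ 2 + A 1 1 ^ 2 = 1 ∧
      A 0 0 * A 1 0 * y ^ 2 + A 0 1 * A 1 1 = 0 := by
    intro y hy
    obtain ⟨-, h1, h2, -⟩ := sl2_formulas A ⟨⟨0, y⟩, hy⟩
    rw [hA] at h1 h2
    change (0 : ℝ) * (A 1 0 ^ 2 * (0 ^ 2 + y ^ 2) + 2 * A 1 0 * A 1 1 * 0 + A 1 1 ^ 2) =
      A 0 0 * A 1 0 * (0 ^ 2 + y ^ 2) + (A 0 0 * A 1 1 + A 0 1 * A 1 0) * 0 + A 0 1 * A 1 1 at h1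
    change y * (A 1 0 ^ 2 * (0 ^ 2 + y ^ 2) + 2 * A 1 0 * A 1 1 * 0 + A 1 1 ^ 2) = y at h2
    constructor
    · apply mul_left_cancel₀ hy.ne'
      linarith
    · linarith
  obtain ⟨k1, k2⟩ := key 1 one_pos
  obtain ⟨k3, k4⟩ := key 2 two_pos
  have hc : A 1 0 = 0 := by
    have : A 1 0 ^ 2 = 0 := by linarith
    exact pow_eq_zero_iff (two_ne_zero) |>.1 this
  rw [hc] at k1 k2 hdet
  have hd : A 1 1 ≠ 0 := by
    intro h
    rw [h] at k1
    simp at k1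
  have hb : A 0 1 = 0 := by
    have : A 0 1 * A 1 1 = 0 := by linarith
    exact (mul_eq_zero.1 this).resolve_right hd
  have ha : A 1 1 = A 0 0 := by
    apply mul_right_cancel₀ hd
    linarith
  rw [Matrix.SpecialLinearGroup.mem_center_iff]
  refine ⟨A 0 0, ?_, ?_⟩
  · simp only [Fintype.card_fin]
    rw [ha] at k1
    linarith
  · ext i j
    fin_cases i <;> fin_cases j <;> simp [hb, hc, ha]

/-- the action on the half plane -/
noncomputable def pslHom : PSL2R →* Equiv.Perm ℍ :=
  QuotientGroup.lift (Subgroup.center SL2R) (MulAction.toPermHom SL2R ℍ) (by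
    intro A hA
    ext1 z
    exact center_smul A hA z)

lemma pslHom_mk (A : SL2R) (z : ℍ) : pslHom (QuotientGroup.mk A) z = A • z := rfl

lemma center_closed : IsClosed (Subgroup.center SL2R : Set SL2R) := by
  have : (Subgroup.center SL2R : Set SL2R) = ⋂ B : SL2R, {A | B * A = A * B} := by
    ext A
    simp [Subgroup.mem_center_iff]
  rw [this]
  exact isClosed_iInter fun B => isClosed_eq (continuous_const_mul B) (continuous_mul_const B)

theorem fuchsian_periodic (Γ : Subgroup PSL2R) (hd : DiscreteTopology Γ) (m : ℕ) :
    Nonempty (groupCohomology (Rep.trivial ℤ Γ ℤ) (m + 3) ≅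
      groupCohomology (Rep.trivial ℤ Γ ℤ) (m + 5)) := by
  let act : MulAction Γ ℍ := MulAction.compHom ℍ (pslHom.comp Γ.subtype)
  have hact : ∀ (g : Γ) (A : SL2R), QuotientGroup.mk A = (g : PSL2R) →
      ∀ z : ℍ, g • z = A • z := by
    intro g A h z
    change pslHom (g : PSL2R) z = _
    rw [← h, pslHom_mk]
  have := center_closed
  refine act_periodic ?_ ?_ ?_ m
  · intro g
    obtain ⟨A, hA⟩ := QuotientGroup.mk_surjective (g : PSL2R)
    exact ⟨A, hact g A hA⟩
  · intro g h
    obtain ⟨A, hA⟩ := QuotientGroup.mk_surjective (g : PSL2R)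
    have h2 := smul_center A fun z => by rw [← hact g A hA, h]
    apply Subtype.ext
    rw [← hA]
    exact (QuotientGroup.eq_one_iff A).2 h2
  · intro p q R
    have hC := (sl2_compact p q R).image (f := (QuotientGroup.mk : SL2R → PSL2R))
      QuotientGroup.continuous_mk
    have ht := Subgroup.tendsto_coe_cofinite_of_discrete Γ
      (isDiscrete_iff_discreteTopology.mpr hd)
    have h1 := ht hC.compl_mem_cocompact
    rw [Filter.mem_map, Filter.mem_cofinite] at h1
    refine h1.subset ?_
    intro g hg
    obtain ⟨A, hA⟩ := QuotientGroup.mk_surjective (g : PSL2R)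
    have hg' : dist (g • p) q ≤ R := hg
    rw [hact g A hA] at hg'
    intro hcon
    exact hcon ⟨A, hg', hA⟩

end psl

end FuchsCoh

/-- Almost periodic cohomology: a cocompact Fuchsian group `Γ` satisfies
`H^m(Γ; ℤ) ≅ H^{m+2}(Γ; ℤ)` for all `m > 2` (group cohomology with trivial
integer coefficients). -/
theorem cocompact_fuchsian_almost_periodic_cohomology
    (Γ : Subgroup PSL2R) (hd : DiscreteTopology Γ) (hc : CompactSpace (PSL2R ⧸ Γ))
    (m : ℕ) (hm : 2 < m) :
    Nonempty (groupCohomology (Rep.trivial ℤ Γ ℤ) m ≅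
      groupCohomology (Rep.trivial ℤ Γ ℤ) (m + 2)) := by
  obtain ⟨k, rfl⟩ : ∃ k, m = k + 3 := ⟨m - 3, by omega⟩
  exact FuchsCoh.fuchsian_periodic Γ hd k
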